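/- arXiv:2503.13112 — 9 statements merged into one kernel-verified Lean document; each statement's English description precedes it below -/
import Mathlib

section
/- Let G be a graph, let c_1, …, c_k be k distinct vertices, let n_1, …, n_k be positive integers with n_1 + … + n_k = |V(G)|, and let T_1, …, T_k be pairwise vertex-disjoint dominating trees of G with {c_1,…,c_k} ⊆ V(T_1). Then there exist an integer l ∈ {1,…,k}, a set I ⊆ {1,…,k} of size l, pairwise disjoint vertex sets (V_i)_{i ∈ I} with |V_i| = n_i, c_i ∈ V_i and G[V_i] connected for every i ∈ I, and a set J ⊆ {1,…,k} of k − l indices such that for every j ∈ J the tree T_j is vertex-disjoint from ⋃_{i ∈ I} V_i, and every terminal c_j with j ∉ I lies outside ⋃_{i ∈ I} V_i. In particular, the trees T_j (j ∈ J) are pairwise vertex-disjoint dominating trees of the graph G − ⋃_{i ∈ I} V_i. -/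
/-- A subgraph `T` of `G` is a dominating tree: it is a tree, and every vertex
of `G` is in `T` or adjacent (in `G`) to a vertex of `T`. -/
def IsDominatingTree {V : Type} (G : SimpleGraph V) (T : G.Subgraph) : Prop :=
  T.coe.IsTree ∧ ∀ v : V, v ∈ T.verts ∨ ∃ u ∈ T.verts, G.Adj v u

section GyoriLovasz

variable {V : Type} {G : SimpleGraph V}

theorem SimpleGraph.connected_induce_singleton (G : SimpleGraph V) (a : V) :
    (G.induce ({a} : Set V)).Connected := by
  have : Nonempty ({a} : Set V) := ⟨⟨a, rfl⟩⟩
  exact SimpleGraph.Connected.of_subsingleton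

theorem SimpleGraph.exists_adj_boundary_of_connected_induce {s a : Set V}
    (hs : (G.induce s).Connected) {x y : V} (hx : x ∈ s) (hxa : x ∈ a) (hy : y ∈ s)
    (hya : y ∉ a) : ∃ p ∈ s, p ∈ a ∧ ∃ q ∈ s, q ∉ a ∧ G.Adj p q := by
  obtain ⟨w⟩ := hs.preconnected ⟨x, hx⟩ ⟨y, hy⟩
  obtain ⟨d, -, h1, h2⟩ := w.exists_boundary_dart (Subtype.val ⁻¹' a) hxa hya
  exact ⟨_, d.fst.2, h1, _, d.snd.2, h2, d.adj⟩

variable {ι : Type} {c : ι → V} {n : ι → ℕ} {o : ι} {P : ι → Finset V} {E : ℕ → Finset V} {r : ℕ}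

/-- The sets `P i` are pairwise disjoint and connected, contain the respective terminals `c i`
and have the prescribed sizes `n i`. -/
structure IsPartialPartition (G : SimpleGraph V) (c : ι → V) (n : ι → ℕ) (P : ι → Finset V) :
    Prop where
  card_eq : ∀ i, (P i).card = n i
  terminal_mem : ∀ i, c i ∈ P i
  connected : ∀ i, (G.induce (P i : Set V)).Connected
  disjoint : Pairwise fun i j => Disjoint (P i) (P j)

theorem IsPartialPartition.eq_of_mem (h : IsPartialPartition G c n P) {i j : ι} {v : V}
    (hi : v ∈ P i) (hj : v ∈ P j) : i = j := by
  by_contra hne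
  exact Finset.disjoint_left.1 (h.disjoint hne) hi hj

/-- Exchanging one part of a partial partition for another set of a possibly different size. -/
theorem IsPartialPartition.update [DecidableEq ι] (h : IsPartialPartition G c n P) {i : ι} {S : Finset V} {m : ℕ}
    (hm : S.card = m) (hc : c i ∈ S) (hconn : (G.induce (S : Set V)).Connected)
    (hdisj : ∀ j, j ≠ i → Disjoint S (P j)) :
    IsPartialPartition G c (Function.update n i m) (Function.update P i S) := by
  refine ⟨fun j => ?_, fun j => ?_, fun j => ?_, fun j l hjl => ?_⟩
  · by_cases hj : j = i
    · subst hj; simpa using hm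
    · simpa [hj] using h.card_eq j
  · by_cases hj : j = i
    · subst hj; simpa using hc
    · simpa [hj] using h.terminal_mem j
  · by_cases hj : j = i
    · subst hj; rwa [Function.update_self]
    · rw [Function.update_of_ne hj]; exact h.connected j
  · by_cases hj : j = i
    · subst hj
      simpa [hjl.symm] using hdisj l hjl.symm
    · by_cases hl : l = i
      · subst hl
        simpa [hj] using (hdisj j hj).symm
      · simpa [hj, hl] using h.disjoint hjl

variable [DecidableEq V]

theorem SimpleGraph.connected_induce_insert {S : Finset V} {x v : V}
    (hS : (G.induce (S : Set V)).Connected) (hx : x ∈ S) (hxv : G.Adj x v) :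
    (G.induce ((insert v S : Finset V) : Set V)).Connected := by
  have h : (G.induce ((S : Set V) ∪ {v})).Connected :=
    SimpleGraph.connected_induce_union hS.preconnected
      (G.connected_induce_singleton v).preconnected
      (Finset.mem_coe.2 hx) rfl hxv
  rwa [Finset.coe_insert, Set.insert_eq, Set.union_comm]

/-- A proper connected part of a finite connected set survives the removal of some vertex
outside of it that keeps the set connected. -/
theorem SimpleGraph.exists_connected_induce_erase {S : Finset V}
    (hS : (G.induce (S : Set V)).Connected) {X : Finset V} (hXS : X ⊂ S)
    (hX : (G.induce (X : Set V)).Connected) :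
    ∃ z ∈ S, z ∉ X ∧ (G.induce (S.erase z : Set V)).Connected := by
  obtain ⟨⟨a, ha⟩⟩ := hX.nonempty
  obtain ⟨b, hbS, hbX⟩ := Finset.exists_of_ssubset hXS
  obtain ⟨p, -, hp, q, hq, hqX, hpq⟩ :=
    SimpleGraph.exists_adj_boundary_of_connected_induce hS (hXS.subset ha) ha hbS
      (show b ∉ (X : Set V) from hbX)
  have hsub : insert q X ⊆ S := Finset.insert_subset hq hXS.subset
  by_cases hE : insert q X = S
  · refine ⟨q, hq, hqX, ?_⟩
    rwa [← hE, Finset.erase_insert hqX]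
  · obtain ⟨z, hz, hzX, hc⟩ := SimpleGraph.exists_connected_induce_erase hS
      (hsub.ssubset_of_ne hE) (SimpleGraph.connected_induce_insert hX hp hpq)
    exact ⟨z, hz, fun h => hzX (Finset.mem_insert_of_mem h), hc⟩
termination_by S.card - X.card
decreasing_by
  rw [Finset.card_insert_of_notMem hqX]
  have := Finset.card_lt_card hXS
  omega

/-- `E'` extends `E` inside the parts of `P`, and it meets every part other than `P o` either not
at all or in a reservoir: a connected set that contains the terminal and misses some vertex of
the part that has a neighbour in `E`. -/
structure IsReservoirStep (G : SimpleGraph V) (c : ι → V) (o : ι) (P : ι → Finset V)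
    (E E' : Finset V) : Prop where
  subset : E ⊆ E'
  covered : ∀ v ∈ E', ∃ i, v ∈ P i
  reservoir : ∀ j, j ≠ o → E' ∩ P j = ∅ ∨
    (c j ∈ E' ∧ (G.induce ((E' ∩ P j : Finset V) : Set V)).Connected ∧
      ∃ w ∈ P j, w ∉ E' ∧ ∃ x ∈ E, G.Adj x w)

/-- The partial partition `P` together with the reservoirs `E 0, …, E r` is lexicographically
optimal with respect to the sizes of the reservoirs. -/
def IsOptimal (G : SimpleGraph V) (c : ι → V) (n : ι → ℕ) (o : ι) :
    ℕ → (ι → Finset V) → (ℕ → Finset V) → Prop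
  | 0, P, E => IsPartialPartition G c n P ∧ E 0 = P o
  | r + 1, P, E => IsOptimal G c n o r P E ∧ IsReservoirStep G c o P (E r) (E (r + 1)) ∧
      ∀ P' E', IsOptimal G c n o r P' E' → IsReservoirStep G c o P' (E' r) (E' (r + 1)) →
        (E' (r + 1)).card ≤ (E (r + 1)).card

theorem IsOptimal.isPartialPartition (h : IsOptimal G c n o r P E) :
    IsPartialPartition G c n P := by
  induction r with
  | zero => exact h.1
  | succ r ih => exact ih h.1

theorem IsOptimal.zero_eq (h : IsOptimal G c n o r P E) : E 0 = P o := by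
  induction r with
  | zero => exact h.2
  | succ r ih => exact ih h.1

theorem IsOptimal.of_le (h : IsOptimal G c n o r P E) {s : ℕ} (hs : s ≤ r) :
    IsOptimal G c n o s P E := by
  induction r with
  | zero => rwa [Nat.le_zero.1 hs]
  | succ r ih =>
    rcases Nat.le_succ_iff.1 hs with hs | rfl
    · exact ih h.1 hs
    · exact h

theorem IsOptimal.step (h : IsOptimal G c n o r P E) {s : ℕ} (hs : s < r) :
    IsReservoirStep G c o P (E s) (E (s + 1)) :=
  (h.of_le hs).2.1

theorem IsOptimal.subset_of_le (h : IsOptimal G c n o r P E) {s t : ℕ} (hst : s ≤ t)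
    (ht : t ≤ r) : E s ⊆ E t := by
  induction t, hst using Nat.le_induction with
  | base => exact subset_rfl
  | succ t _ ih => exact (ih (by omega)).trans (h.step ht).subset

theorem IsOptimal.covered (h : IsOptimal G c n o r P E) {v : V} (hv : v ∈ E r) :
    ∃ i, v ∈ P i := by
  cases r with
  | zero => exact ⟨o, h.zero_eq ▸ hv⟩
  | succ r => exact h.2.1.covered v hv

/-- Optimality transfers to any other valid choice of parts and reservoirs with the same
reservoir sizes. -/
theorem IsOptimal.transfer (h : IsOptimal G c n o r P E) {P' : ι → Finset V} {E' : ℕ → Finset V}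
    (hP : IsPartialPartition G c n P') (h0 : E' 0 = P' o)
    (hstep : ∀ s < r, IsReservoirStep G c o P' (E' s) (E' (s + 1)))
    (hcard : ∀ s ≤ r, (E' s).card = (E s).card) : IsOptimal G c n o r P' E' := by
  induction r with
  | zero => exact ⟨hP, h0⟩
  | succ r ih =>
    refine ⟨ih h.1 (fun s hs => hstep s (by omega)) (fun s hs => hcard s (by omega)),
      hstep r (by omega), fun P'' E'' h1 h2 => ?_⟩
    rw [hcard _ le_rfl]
    exact h.2.2 P'' E'' h1 h2

theorem IsOptimal.congr_of_le (h : IsOptimal G c n o r P E) {E' : ℕ → Finset V}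
    (hE : ∀ s ≤ r, E' s = E s) : IsOptimal G c n o r P E' := by
  refine h.transfer h.isPartialPartition ((hE 0 (by omega)).trans h.zero_eq) (fun s hs => ?_)
    (fun s hs => by rw [hE s hs])
  rw [hE s (by omega), hE (s + 1) hs]
  exact h.step hs

theorem IsOptimal.exists_succ [Fintype V] (h : IsOptimal G c n o r P E) :
    ∃ P' E', IsOptimal G c n o (r + 1) P' E' := by
  let S : Set ℕ := {m | ∃ P' E', IsOptimal G c n o r P' E' ∧
    IsReservoirStep G c o P' (E' r) (E' (r + 1)) ∧ (E' (r + 1)).card = m}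
  have hne : S.Nonempty := by
    refine ⟨_, P, Function.update E (r + 1) (E r),
      h.congr_of_le fun s hs => Function.update_of_ne (by omega) _ _, ?_, rfl⟩
    rw [Function.update_of_ne (by omega), Function.update_self]
    refine ⟨subset_rfl, fun v hv => h.covered hv, fun j hj => ?_⟩
    cases r with
    | zero =>
      left
      rw [h.zero_eq]
      exact Finset.disjoint_iff_inter_eq_empty.1 (h.isPartialPartition.disjoint hj.symm)
    | succ r =>
      rcases h.2.1.reservoir j hj with h0 | ⟨h1, h2, w, h3, h4, x, h5, h6⟩
      · exact Or.inl h0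
      · exact Or.inr ⟨h1, h2, w, h3, h4, x, h.2.1.subset h5, h6⟩
  have hbdd : BddAbove S := by
    refine ⟨Fintype.card V, ?_⟩
    rintro m ⟨P', E', -, -, rfl⟩
    exact Finset.card_le_univ _
  obtain ⟨P', E', h1, h2, h3⟩ := Nat.sSup_mem hne hbdd
  exact ⟨P', E', h1, h2, fun P'' E'' h4 h5 => h3 ▸ le_csSup hbdd ⟨P'', E'', h4, h5, rfl⟩⟩

theorem IsPartialPartition.exists_isOptimal [Fintype V] (h : IsPartialPartition G c n P) (o : ι) (r : ℕ) :
    ∃ P' E', IsOptimal G c n o r P' E' := by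
  induction r with
  | zero => exact ⟨P, fun _ => P o, h, rfl⟩
  | succ r ih =>
    obtain ⟨P', E', h'⟩ := ih
    exact h'.exists_succ

theorem IsPartialPartition.exists_isOptimal_stable [Fintype V] (h : IsPartialPartition G c n P) (o : ι) :
    ∃ r P' E', IsOptimal G c n o (r + 1) P' E' ∧ E' r = E' (r + 1) := by
  obtain ⟨P', E', hopt⟩ := h.exists_isOptimal o (Fintype.card V + 1)
  by_contra! hcon
  have hcard : ∀ r ≤ Fintype.card V + 1, r ≤ (E' r).card := by
    intro r
    induction r with
    | zero => simp
    | succ r ih =>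
      intro hr
      have hlt := Finset.card_lt_card (((hopt.step hr).subset).ssubset_of_ne
        (hcon r P' E' (hopt.of_le hr)))
      have := ih (by omega)
      omega
  have h1 := hcard _ le_rfl
  have h2 := Finset.card_le_univ (E' (Fintype.card V + 1))
  omega

variable [DecidableEq ι]

/-- In an optimal choice every admissible reservoir has been exhausted. -/
theorem IsOptimal.reservoir_subset (h : IsOptimal G c n o (r + 1) P E) {j : ι} (hj : j ≠ o)
    {Y : Finset V} (hYP : Y ⊆ P j) (hEY : E (r + 1) ∩ P j ⊆ Y) (hcY : c j ∈ Y)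
    (hY : (G.induce (Y : Set V)).Connected) {w x : V} (hw : w ∈ P j) (hwY : w ∉ Y)
    (hx : x ∈ E r) (hxw : G.Adj x w) : Y ⊆ E (r + 1) := by
  have hP := h.isPartialPartition
  have hle := h.2.2 P (Function.update E (r + 1) (E (r + 1) ∪ Y))
    (h.1.congr_of_le fun s hs => Function.update_of_ne (by omega) _ _) (by
      rw [Function.update_of_ne (by omega), Function.update_self]
      refine ⟨h.2.1.subset.trans Finset.subset_union_left, fun v hv => ?_, fun m hm => ?_⟩
      · rcases Finset.mem_union.1 hv with hv | hv
        · exact h.2.1.covered v hv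
        · exact ⟨j, hYP hv⟩
      · by_cases hmj : m = j
        · subst hmj
          have : (E (r + 1) ∪ Y) ∩ P m = Y := by
            rw [Finset.union_inter_distrib_right, Finset.inter_eq_left.2 hYP,
              Finset.union_eq_right.2 hEY]
          rw [this]
          refine Or.inr ⟨Finset.mem_union_right _ hcY, hY, w, hw, fun hmem => ?_, x, hx, hxw⟩
          rcases Finset.mem_union.1 hmem with hmem | hmem
          · exact hwY (hEY (Finset.mem_inter.2 ⟨hmem, hw⟩))
          · exact hwY hmem
        · have hd : ∀ v ∈ P m, v ∉ Y := fun v hv hvY => hmj (hP.eq_of_mem hv (hYP hvY))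
          have : (E (r + 1) ∪ Y) ∩ P m = E (r + 1) ∩ P m := by
            ext v
            simp only [Finset.mem_inter, Finset.mem_union]
            have := hd v
            tauto
          rw [this]
          rcases h.2.1.reservoir m hm with h0 | ⟨h1, h2, w', h3, h4, h5⟩
          · exact Or.inl h0
          · refine Or.inr ⟨Finset.mem_union_left _ h1, h2, w', h3, fun hmem => ?_, h5⟩
            rcases Finset.mem_union.1 hmem with hmem | hmem
            · exact h4 hmem
            · exact hd _ h3 hmem)
  rw [Function.update_self] at hle
  rw [Finset.eq_of_subset_of_card_le Finset.subset_union_left hle]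
  exact Finset.subset_union_right

theorem IsPartialPartition.exchange (h : IsPartialPartition G c n P) {i : ι}
    {z u : V} (hz : z ∈ P i) (hu : ∀ j, u ∉ P j) (hcz : c i ≠ z)
    (hconn : (G.induce ((insert u ((P i).erase z) : Finset V) : Set V)).Connected) :
    IsPartialPartition G c n (Function.update P i (insert u ((P i).erase z))) := by
  have hcard : (insert u ((P i).erase z)).card = n i := by
    rw [Finset.card_insert_of_notMem fun hmem => hu i (Finset.mem_of_mem_erase hmem),
      Finset.card_erase_add_one hz, h.card_eq]
  have := h.update hcard (Finset.mem_insert_of_mem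
    (Finset.mem_erase.2 ⟨hcz, h.terminal_mem i⟩)) hconn fun j hj => by
      rw [Finset.disjoint_left]
      intro v hv hvj
      rcases Finset.mem_insert.1 hv with rfl | hv
      · exact hu j hvj
      · exact hj (h.eq_of_mem hvj (Finset.mem_of_mem_erase hv))
  rwa [Function.update_eq_self] at this

/-- An unassigned vertex may replace a vertex `z` outside the reservoirs that has no neighbour in
the earlier reservoirs. -/
theorem IsOptimal.exchange (h : IsOptimal G c n o r P E) {i : ι} (hi : i ≠ o)
    {z u : V} (hz : z ∈ P i) (hu : ∀ j, u ∉ P j) (hcz : c i ≠ z)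
    (hconn : (G.induce ((insert u ((P i).erase z) : Finset V) : Set V)).Connected)
    (hzE : z ∉ E r) (hzadj : ∀ s < r, ∀ x ∈ E s, ¬ G.Adj x z) :
    IsOptimal G c n o r (Function.update P i (insert u ((P i).erase z))) E := by
  have hP := h.isPartialPartition
  refine h.transfer (hP.exchange hz hu hcz hconn) ?_ (fun s hs => ?_) (fun _ _ => rfl)
  · rw [Function.update_of_ne hi.symm, h.zero_eq]
  have hstep := h.step hs
  have hzE' : z ∉ E (s + 1) := fun hmem => hzE (h.subset_of_le hs le_rfl hmem)
  have huE : u ∉ E (s + 1) := fun hmem => (hstep.covered u hmem).elim hu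
  refine ⟨hstep.subset, fun v hv => ?_, fun j hj => ?_⟩
  · obtain ⟨j, hvj⟩ := hstep.covered v hv
    refine ⟨j, ?_⟩
    by_cases hji : j = i
    · subst hji
      rw [Function.update_self]
      exact Finset.mem_insert_of_mem (Finset.mem_erase.2 ⟨fun e => hzE' (e ▸ hv), hvj⟩)
    · rwa [Function.update_of_ne hji]
  · by_cases hji : j = i
    · subst hji
      rw [Function.update_self]
      have : E (s + 1) ∩ insert u ((P j).erase z) = E (s + 1) ∩ P j := by
        ext v
        simp only [Finset.mem_inter, Finset.mem_insert, Finset.mem_erase]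
        refine ⟨fun ⟨h1, h2⟩ => ⟨h1, ?_⟩, fun ⟨h1, h2⟩ => ⟨h1, Or.inr ⟨?_, h2⟩⟩⟩
        · rcases h2 with rfl | h2
          · exact absurd h1 huE
          · exact h2.2
        · rintro rfl
          exact hzE' h1
      rw [this]
      rcases hstep.reservoir j hj with h0 | ⟨h1, h2, w, h3, h4, x, h5, h6⟩
      · exact Or.inl h0
      · refine Or.inr ⟨h1, h2, w, Finset.mem_insert_of_mem (Finset.mem_erase.2 ⟨?_, h3⟩), h4,
          x, h5, h6⟩
        rintro rfl
        exact hzadj s hs x h5 h6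
    · rw [Function.update_of_ne hji]
      exact hstep.reservoir j hj

/-- If the part `P o` cannot be enlarged, then no unassigned vertex has a neighbour in an optimal
reservoir. -/
theorem IsOptimal.not_adj_of_notMem
    (hmax : ¬ ∃ P', IsPartialPartition G c (Function.update n o (n o + 1)) P')
    (h : IsOptimal G c n o r P E) {u x : V} (hu : ∀ j, u ∉ P j) (hx : x ∈ E r) :
    ¬ G.Adj x u := by
  induction r generalizing P E u x with
  | zero =>
    intro hxu
    have hP := h.isPartialPartition
    rw [h.zero_eq] at hx
    refine hmax ⟨_, hP.update (i := o) (S := insert u (P o)) ?_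
      (Finset.mem_insert_of_mem (hP.terminal_mem o))
      (SimpleGraph.connected_induce_insert (hP.connected o) hx hxu) fun j hj => ?_⟩
    · rw [Finset.card_insert_of_notMem (hu o), hP.card_eq]
    · rw [Finset.disjoint_insert_left]
      exact ⟨hu j, hP.disjoint hj.symm⟩
  | succ r ih =>
    intro hxu
    have hP := h.isPartialPartition
    by_cases hxr : x ∈ E r
    · exact ih h.1 hu hxr hxu
    obtain ⟨i, hxi⟩ := h.covered hx
    have hi : i ≠ o := by
      rintro rfl
      exact hxr (h.subset_of_le (Nat.zero_le r) (by omega) (h.zero_eq ▸ hxi))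
    rcases h.2.1.reservoir i hi with h0 | ⟨hcE, hconn, w, hw, hwE, y, hy, hyw⟩
    · exact Finset.notMem_empty x (h0 ▸ Finset.mem_inter.2 ⟨hx, hxi⟩)
    set X := E (r + 1) ∩ P i with hXdef
    have hxX : x ∈ X := Finset.mem_inter.2 ⟨hx, hxi⟩
    have hcX : c i ∈ X := Finset.mem_inter.2 ⟨hcE, hP.terminal_mem i⟩
    have hwX : w ∉ X := fun hmem => hwE (Finset.mem_inter.1 hmem).1
    have hXE : ∀ v ∈ P i, v ∉ X → v ∉ E (r + 1) := fun v hv hvX hmem =>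
      hvX (Finset.mem_inter.2 ⟨hmem, hv⟩)
    have hnbr : ∀ v ∈ P i, v ∉ X → ∀ a ∈ X, G.Adj a v → v = w := by
      intro v hv hvX a ha hav
      by_contra hvw
      refine hXE v hv hvX (h.reservoir_subset hi (Y := insert v X)
        (Finset.insert_subset hv Finset.inter_subset_right) (Finset.subset_insert _ _)
        (Finset.mem_insert_of_mem hcX) (SimpleGraph.connected_induce_insert hconn ha hav) hw ?_
        hy hyw (Finset.mem_insert_self _ _))
      rw [Finset.mem_insert]
      rintro (e | e)
      · exact hvw e.symm
      · exact hwX e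
    have hXw : (G.induce ((insert w X : Finset V) : Set V)).Connected := by
      obtain ⟨p, -, hp, q, hq, hqX, hpq⟩ :=
        SimpleGraph.exists_adj_boundary_of_connected_induce (hP.connected i) (a := (X : Set V))
          hxi hxX hw hwX
      obtain rfl := hnbr q hq hqX p hp hpq
      exact SimpleGraph.connected_induce_insert hconn hp hpq
    have hsub : insert w X ⊆ P i := Finset.insert_subset hw Finset.inter_subset_right
    by_cases hall : insert w X = P i
    · have herase : (P i).erase w = X := by rw [← hall, Finset.erase_insert hwX]
      refine ih (P := Function.update P i (insert u ((P i).erase w))) (E := E) (u := w) (x := y)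
        (h.1.exchange hi hw hu (fun e => hwX (e ▸ hcX)) ?_
          (fun hmem => hwE (h.2.1.subset hmem)) ?_) (fun j hj => ?_) hy hyw
      · rw [herase]
        exact SimpleGraph.connected_induce_insert hconn hxX hxu
      · intro s hs a ha haw
        have hs' : IsOptimal G c n o (s + 1) P E := h.of_le (by omega)
        have hle : E (s + 1) ⊆ E (r + 1) := h.subset_of_le (by omega) le_rfl
        have hXs := hs'.reservoir_subset hi (Y := X) Finset.inter_subset_right
          (Finset.inter_subset_inter_right hle) hcX hconn hw hwX ha haw
        exact hxr (h.subset_of_le (show s + 1 ≤ r by omega) (by omega) (hXs hxX))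
      · by_cases hji : j = i
        · subst hji
          rw [Function.update_self] at hj
          rcases Finset.mem_insert.1 hj with rfl | hj
          · exact hu _ hw
          · exact Finset.notMem_erase _ _ hj
        · rw [Function.update_of_ne hji] at hj
          exact hji (hP.eq_of_mem hj hw)
    · obtain ⟨z, hz, hzX, hzconn⟩ := SimpleGraph.exists_connected_induce_erase (hP.connected i)
        (hsub.ssubset_of_ne hall) hXw
      rw [Finset.mem_insert, not_or] at hzX
      have hzE : z ∉ E (r + 1) := hXE z hz hzX.2
      have hzadj : ∀ a ∈ E r, ¬ G.Adj a z := by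
        intro a ha haz
        refine hwE (h.reservoir_subset hi (Y := insert w X) hsub (Finset.subset_insert _ _)
          (Finset.mem_insert_of_mem hcX) hXw hz ?_ ha haz (Finset.mem_insert_self _ _))
        rw [Finset.mem_insert, not_or]
        exact hzX
      have hxz : x ∈ (P i).erase z := Finset.mem_erase.2 ⟨fun e => hzX.2 (e ▸ hxX), hxi⟩
      have hopt := h.1.exchange hi hz hu (fun e => hzX.2 (e ▸ hcX))
        (SimpleGraph.connected_induce_insert hzconn hxz hxu)
        (fun hmem => hzE (h.2.1.subset hmem)) (fun s hs a ha =>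
          hzadj a (h.subset_of_le hs.le (by omega) ha))
      have huE : u ∉ E (r + 1) := fun hmem => (h.covered hmem).elim hu
      have hle := h.2.2 _ (Function.update E (r + 1) (insert u (E (r + 1))))
        (hopt.congr_of_le fun s hs => Function.update_of_ne (by omega) _ _) (by
          rw [Function.update_of_ne (by omega), Function.update_self]
          refine ⟨h.2.1.subset.trans (Finset.subset_insert _ _), fun v hv => ?_, fun j hj => ?_⟩
          · rcases Finset.mem_insert.1 hv with rfl | hv
            · exact ⟨i, by rw [Function.update_self]; exact Finset.mem_insert_self _ _⟩
            · obtain ⟨j, hvj⟩ := h.covered hv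
              refine ⟨j, ?_⟩
              by_cases hji : j = i
              · subst hji
                rw [Function.update_self]
                exact Finset.mem_insert_of_mem
                  (Finset.mem_erase.2 ⟨fun e => hzE (e ▸ hv), hvj⟩)
              · rwa [Function.update_of_ne hji]
          · by_cases hji : j = i
            · subst hji
              rw [Function.update_self]
              have : insert u (E (r + 1)) ∩ insert u ((P j).erase z) = insert u X := by
                ext v
                simp only [Finset.mem_inter, Finset.mem_insert, Finset.mem_erase, hXdef]
                have : v ∈ E (r + 1) → v ≠ z := fun hv e => hzE (e ▸ hv)
                tauto
              rw [this]
              refine Or.inr ⟨Finset.mem_insert_of_mem hcE,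
                SimpleGraph.connected_induce_insert hconn hxX hxu, w,
                Finset.mem_insert_of_mem (Finset.mem_erase.2 ⟨Ne.symm hzX.1, hw⟩), ?_, y, hy, hyw⟩
              rw [Finset.mem_insert, not_or]
              exact ⟨fun e => hu j (e ▸ hw), hwE⟩
            · rw [Function.update_of_ne hji]
              have hne : ∀ v ∈ P j, v ≠ u := fun v hv e => hu j (e ▸ hv)
              have : insert u (E (r + 1)) ∩ P j = E (r + 1) ∩ P j :=
                Finset.insert_inter_of_notMem (hu j)
              rw [this]
              rcases h.2.1.reservoir j hj with h0 | ⟨h1, h2, w', h3, h4, h5⟩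
              · exact Or.inl h0
              · refine Or.inr ⟨Finset.mem_insert_of_mem h1, h2, w', h3, ?_, h5⟩
                rw [Finset.mem_insert, not_or]
                exact ⟨hne _ h3, h4⟩)
      rw [Function.update_self, Finset.card_insert_of_notMem huE] at hle
      omega

/-- Once the reservoirs have stabilised, every part has at most one vertex outside of them that
is adjacent to them. -/
theorem IsOptimal.eq_of_adj (h : IsOptimal G c n o (r + 1) P E) (hE : E r = E (r + 1)) {j : ι}
    {y y' a a' : V} (hy : y ∈ P j) (hy' : y' ∈ P j) (hyE : y ∉ E r) (hyE' : y' ∉ E r)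
    (ha : a ∈ E r) (ha' : a' ∈ E r) (hay : G.Adj a y) (hay' : G.Adj a' y') : y = y' := by
  have hP := h.isPartialPartition
  by_contra hne
  have hj : j ≠ o := by
    rintro rfl
    exact hyE (h.subset_of_le (Nat.zero_le r) (by omega) (h.zero_eq ▸ hy))
  rcases h.2.1.reservoir j hj with h0 | ⟨hcE, hconn, -⟩
  · have hcj : c j ∉ E (r + 1) := fun hmem =>
      Finset.notMem_empty (c j) (h0 ▸ Finset.mem_inter.2 ⟨hmem, hP.terminal_mem j⟩)
    have key : ∀ v ∈ P j, ∀ b ∈ E r, G.Adj b v → v = c j := by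
      intro v hv b hb hbv
      by_contra hvc
      refine hcj (h.reservoir_subset hj (Y := {c j})
        (Finset.singleton_subset_iff.2 (hP.terminal_mem j)) (by simp [h0])
        (Finset.mem_singleton_self _) ?_ hv (by simpa using hvc) hb hbv
        (Finset.mem_singleton_self _))
      rw [Finset.coe_singleton]
      exact G.connected_induce_singleton _
    exact hne ((key y hy a ha hay).trans (key y' hy' a' ha' hay').symm)
  · have key : ∀ v ∈ P j, v ∉ E r → ∀ b ∈ E r, G.Adj b v →
        ∀ p ∈ E (r + 1) ∩ P j, ∀ q ∈ P j, q ∉ E (r + 1) ∩ P j → G.Adj p q → q = v := by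
      intro v hv hvE b hb hbv p hp q hq hqX hpq
      by_contra hqv
      refine hqX (Finset.mem_inter.2 ⟨h.reservoir_subset hj (Y := insert q (E (r + 1) ∩ P j))
        (Finset.insert_subset hq Finset.inter_subset_right) (Finset.subset_insert _ _)
        (Finset.mem_insert_of_mem (Finset.mem_inter.2 ⟨hcE, hP.terminal_mem j⟩))
        (SimpleGraph.connected_induce_insert hconn hp hpq) hv ?_ hb hbv
        (Finset.mem_insert_self _ _), hq⟩)
      rw [Finset.mem_insert, not_or, Finset.mem_inter, ← hE]
      exact ⟨Ne.symm hqv, fun hmem => hvE hmem.1⟩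
    obtain ⟨p, -, hp, q, hq, hqX, hpq⟩ :=
      SimpleGraph.exists_adj_boundary_of_connected_induce (hP.connected j)
        (a := ((E (r + 1) ∩ P j : Finset V) : Set V)) (hP.terminal_mem j)
        (Finset.mem_inter.2 ⟨hcE, hP.terminal_mem j⟩) hy
        (fun hmem => hyE (hE ▸ (Finset.mem_inter.1 hmem).1))
    exact hne ((key y hy hyE a ha hay p hp q hq hqX hpq).symm.trans
      (key y' hy' hyE' a' ha' hay' p hp q hq hqX hpq))

variable [Fintype V] [Fintype ι]

/-- If `G` has as many disjoint dominating trees as there are terminals, then any part of a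
partial partition that leaves some vertex unassigned can be enlarged, at the cost of changing
the other parts. -/
theorem IsPartialPartition.exists_update_succ (h : IsPartialPartition G c n P)
    (T : ι → G.Subgraph) (hT : ∀ i, IsDominatingTree G (T i))
    (hTdisj : Pairwise fun i j => Disjoint (T i).verts (T j).verts)
    (hsum : ∑ i, n i < Fintype.card V) (o : ι) :
    ∃ P', IsPartialPartition G c (Function.update n o (n o + 1)) P' := by
  by_contra hmax
  obtain ⟨r, P, E, hopt, hE⟩ := h.exists_isOptimal_stable o
  have hP := hopt.isPartialPartition
  have hoE : P o ⊆ E r := hopt.zero_eq ▸ hopt.subset_of_le (Nat.zero_le r) (by omega)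
  obtain ⟨u, hu⟩ : ∃ u, ∀ j, u ∉ P j := by
    by_contra! hcov
    have huniv : Finset.univ.biUnion P = Finset.univ := by
      ext v
      simpa using hcov v
    have hc := Finset.card_biUnion_le (s := Finset.univ) (t := P)
    rw [huniv, Finset.card_univ, Finset.sum_congr rfl fun i _ => hP.card_eq i] at hc
    exact hc.not_gt hsum
  have huE : u ∉ E r := fun hmem => (hopt.1.covered hmem).elim hu
  obtain ⟨m, hm⟩ : ∃ m, ∀ v ∈ (T m).verts, v ∉ E r → ∀ a ∈ E r, ¬ G.Adj a v := by
    by_contra! hcon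
    choose f hfT hfE a ha hadj using hcon
    have hfP : ∀ m, ∃ j, f m ∈ P j := by
      intro m
      by_contra! hnone
      exact hopt.1.not_adj_of_notMem hmax hnone (ha m) (hadj m)
    choose g hg using hfP
    have hinj : Function.Injective g := by
      intro m m' hmm
      have heq : f m = f m' := hopt.eq_of_adj hE (hg m) (hmm ▸ hg m') (hfE m) (hfE m')
        (ha m) (ha m') (hadj m) (hadj m')
      by_contra hne
      exact Set.disjoint_left.1 (hTdisj hne) (hfT m) (heq ▸ hfT m')
    obtain ⟨m, hm⟩ := (Finite.injective_iff_surjective.1 hinj) o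
    exact hfE m (hoE (hm ▸ hg m))
  have hconn : (G.induce (T m).verts).Connected :=
    SimpleGraph.Subgraph.Connected.induce_verts ⟨(hT m).1.connected⟩
  have hco : c o ∈ E r := hoE (hP.terminal_mem o)
  obtain ⟨b, hbT, hbE⟩ : ∃ b ∈ (T m).verts, b ∈ E r := by
    rcases (hT m).2 (c o) with hc | ⟨b, hb, hadj⟩
    · exact ⟨_, hc, hco⟩
    · exact ⟨b, hb, by_contra fun hbE => hm b hb hbE _ hco hadj⟩
  have hTE : ∀ v ∈ (T m).verts, v ∈ E r := by
    intro v hv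
    by_contra hvE
    obtain ⟨p, -, hp, q, hq, hqE, hpq⟩ :=
      SimpleGraph.exists_adj_boundary_of_connected_induce hconn (a := (E r : Set V))
        hbT hbE hv hvE
    exact hm q hq hqE p hp hpq
  rcases (hT m).2 u with hc | ⟨b, hb, hadj⟩
  · exact huE (hTE u hc)
  · exact hopt.1.not_adj_of_notMem hmax hu (hTE b hb) hadj.symm

/-- The Győri–Lovász theorem for graphs with `k` disjoint dominating trees. -/
theorem exists_isPartialPartition_of_isDominatingTree (hc : Function.Injective c)
    (hpos : ∀ i, 0 < n i) (hsum : ∑ i, n i ≤ Fintype.card V)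
    (T : ι → G.Subgraph) (hT : ∀ i, IsDominatingTree G (T i))
    (hTdisj : Pairwise fun i j => Disjoint (T i).verts (T j).verts) :
    ∃ P, IsPartialPartition G c n P := by
  induction hN : ∑ i, n i using Nat.strong_induction_on generalizing n with
  | _ N ih =>
    by_cases hone : ∀ i, n i = 1
    · refine ⟨fun i => {c i}, fun i => by simp [hone], fun i => by simp, fun i => ?_,
        fun i j hij => ?_⟩
      · rw [Finset.coe_singleton]
        exact G.connected_induce_singleton _
      · simpa using hc.ne hij
    · push Not at hone
      obtain ⟨o, ho⟩ := hone
      have hopos := hpos o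
      have hlt : ∑ i, Function.update n o (n o - 1) i < ∑ i, n i := by
        refine Finset.sum_lt_sum (fun i _ => ?_) ⟨o, Finset.mem_univ _, ?_⟩
        · by_cases hi : i = o
          · subst hi; simp
          · simp [hi]
        · rw [Function.update_self]; omega
      obtain ⟨P, hP⟩ := ih _ (hN ▸ hlt) (n := Function.update n o (n o - 1)) (fun i => by
        by_cases hi : i = o
        · subst hi
          rw [Function.update_self]; omega
        · simpa [hi] using hpos i) (hlt.le.trans hsum) rfl
      have := hP.exists_update_succ T hT hTdisj (hlt.trans_le hsum) o
      rwa [Function.update_idem, Function.update_self, Nat.sub_add_cancel hopos,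
        Function.update_eq_self] at this

end GyoriLovasz

/-- Given `k` pairwise vertex-disjoint dominating trees of `G` with all terminals in the
first tree, there exist `l ∈ {1,…,k}`, an index set `I` of size `l`, pairwise disjoint sets
`(W i)_{i ∈ I}` of the prescribed sizes, each containing its terminal and inducing a
connected subgraph, and a set `J` of `k - l` indices such that each tree `T j` (`j ∈ J`)
is vertex-disjoint from `⋃_{i ∈ I} W i`, and every terminal `c j` with `j ∉ I` lies
outside `⋃_{i ∈ I} W i`. -/
theorem gl_aux_partial_partition {V : Type} [Fintype V] [DecidableEq V]
    (G : SimpleGraph V) (k : ℕ) (hk : 0 < k)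
    (c : Fin k → V) (hc : Function.Injective c)
    (n : Fin k → ℕ) (hpos : ∀ i, 0 < n i)
    (hsum : ∑ i, n i = Fintype.card V)
    (T : Fin k → G.Subgraph) (hT : ∀ i, IsDominatingTree G (T i))
    (hTdisj : Pairwise fun i j => Disjoint (T i).verts (T j).verts)
    (hcT : ∀ i, c i ∈ (T ⟨0, hk⟩).verts) :
    ∃ l : ℕ, 1 ≤ l ∧ l ≤ k ∧
    ∃ (I : Finset (Fin k)) (W : Fin k → Finset V),
      I.card = l ∧
      (∀ i ∈ I, ∀ j ∈ I, i ≠ j → Disjoint (W i) (W j)) ∧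
      (∀ i ∈ I, (W i).card = n i ∧ c i ∈ W i ∧
        (G.induce (↑(W i) : Set V)).Connected) ∧
      ∃ J : Finset (Fin k),
        J.card = k - l ∧
        (∀ j ∈ J, Disjoint ((T j).verts) (↑(I.biUnion W) : Set V)) ∧
        (∀ j : Fin k, j ∉ I → c j ∉ I.biUnion W) := by
  obtain ⟨P, hP⟩ := exists_isPartialPartition_of_isDominatingTree hc hpos hsum.le T hT hTdisj
  refine ⟨k, hk, le_rfl, Finset.univ, P, by simp, fun i _ j _ hij => hP.disjoint hij,
    fun i _ => ⟨hP.card_eq i, hP.terminal_mem i, hP.connected i⟩, ∅, by simp, by simp, by simp⟩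
end

section
/- Let G be a graph, let c_1, …, c_k be k distinct vertices, let n_1, …, n_k be positive integers with n_1 + … + n_k = |V(G)|, and let V_1, …, V_k be pairwise disjoint vertex sets with c_i ∈ V_i and |V_i| ≤ n_i for every i. Let T^1, …, T^k be pairwise vertex-disjoint trees in G, each terminal c_i lying in exactly one tree, and suppose: (i) the trees containing no terminal (the family 𝒯_0) are vertex-disjoint from every V_i; (ii) every tree containing at least one terminal has all its vertices contained in V_1 ∪ … ∪ V_k; (iii) every vertex of G lies either in a tree of 𝒯_0 or in some V_i; (iv) at least one tree contains at least two terminals. Suppose further that to each tree T containing l ≥ 2 terminals there are assigned l − 1 trees of 𝒯_0, with the assigned sets pairwise disjoint over different such trees and together exhausting 𝒯_0. Then there exists a tree T containing l ≥ 2 terminals c_{i_1}, …, c_{i_l}, with assigned 𝒯_0-trees T'_1, …, T'_{l−1}, such that |V(T)| + Σ_{j=1}^{l−1} |V(T'_j)| ≥ Σ_{j=1}^{l} (n_{i_j} − |V_{i_j}|). -/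
/-- The number of terminals (among `c 0, …, c (k-1)`) contained in the vertex set `S`. -/
noncomputable def termCount {V : Type} {k : ℕ} (c : Fin k → V) (S : Set V) : ℕ :=
  {i : Fin k | c i ∈ S}.ncard

/-- Choosing a suitable tree set: given pairwise disjoint connected partial sets `W i`
(with `c i ∈ W i`, `|W i| ≤ n i`), pairwise vertex-disjoint trees `T j` (each terminal
in exactly one tree), such that (i) terminal-free trees avoid all `W i`, (ii) trees with a
terminal are contained in `⋃ W i`, (iii) every vertex is in a terminal-free tree or some
`W i`, (iv) some tree has at least two terminals, and an assignment `asg` giving each tree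
with `l ≥ 2` terminals `l - 1` terminal-free trees, pairwise disjointly and exhausting all
terminal-free trees — then some tree with at least two terminals together with its
assigned trees has at least as many vertices as the total remaining demand of the vertex
sets of its terminals. -/
theorem exists_good_tree_set {V : Type} [Fintype V] [DecidableEq V]
    (G : SimpleGraph V) (k : ℕ)
    (c : Fin k → V) (hc : Function.Injective c)
    (n : Fin k → ℕ) (hpos : ∀ i, 0 < n i)
    (hsum : ∑ i, n i = Fintype.card V)
    (W : Fin k → Finset V)
    (hWdisj : Pairwise fun i j => Disjoint (W i) (W j))
    (hcW : ∀ i, c i ∈ W i) (hWle : ∀ i, (W i).card ≤ n i)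
    (T : Fin k → G.Subgraph) (hTtree : ∀ j, (T j).coe.IsTree)
    (hTdisj : Pairwise fun i j => Disjoint (T i).verts (T j).verts)
    (huniq : ∀ i : Fin k, ∃! j : Fin k, c i ∈ (T j).verts)
    (hT0 : ∀ j : Fin k, termCount c (T j).verts = 0 →
      ∀ i : Fin k, Disjoint ((T j).verts) (↑(W i) : Set V))
    (hT1 : ∀ j : Fin k, 0 < termCount c (T j).verts →
      (T j).verts ⊆ ⋃ i : Fin k, (↑(W i) : Set V))
    (hall : ∀ v : V,
      (∃ j : Fin k, termCount c (T j).verts = 0 ∧ v ∈ (T j).verts) ∨ ∃ i, v ∈ W i)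
    (hsome : ∃ j : Fin k, 2 ≤ termCount c (T j).verts)
    (asg : Fin k → Finset (Fin k))
    (hasg : ∀ j : Fin k, 2 ≤ termCount c (T j).verts →
      (∀ j' ∈ asg j, termCount c (T j').verts = 0) ∧
      (asg j).card = termCount c (T j).verts - 1)
    (hasgdisj : ∀ j j' : Fin k, j ≠ j' → 2 ≤ termCount c (T j).verts →
      2 ≤ termCount c (T j').verts → Disjoint (asg j) (asg j'))
    (hasgall : ∀ j' : Fin k, termCount c (T j').verts = 0 →
      ∃ j : Fin k, 2 ≤ termCount c (T j).verts ∧ j' ∈ asg j) :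
    ∃ j : Fin k, 2 ≤ termCount c (T j).verts ∧
      ∃ Ij : Finset (Fin k), (∀ i : Fin k, i ∈ Ij ↔ c i ∈ (T j).verts) ∧
        ∑ i ∈ Ij, (n i - (W i).card) ≤
          (T j).verts.ncard + ∑ j' ∈ asg j, (T j').verts.ncard := by
  classical
  set d : Fin k → ℕ := fun i => n i - (W i).card
  set B : Finset (Fin k) := {j | 2 ≤ termCount c (T j).verts} with hB
  set Z : Finset (Fin k) := {j | termCount c (T j).verts = 0} with hZ
  have hBne : B.Nonempty := by
    obtain ⟨j, hj⟩ := hsome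
    exact ⟨j, by simpa [hB] using hj⟩
  have demand_le : ∑ j ∈ B, ∑ i with c i ∈ (T j).verts, d i ≤ ∑ i, d i := by
    rw [← Finset.sum_biUnion]
    · exact Finset.sum_le_sum_of_subset (Finset.subset_univ _)
    · intro j _ j' _ hne
      refine Finset.disjoint_left.2 fun i hi hi' => hne ?_
      exact (huniq i).unique (by simpa using hi) (by simpa using hi')
  have demand_eq : ∑ i, d i + ∑ i, (W i).card = Fintype.card V := by
    rw [← Finset.sum_add_distrib, ← hsum]
    exact Finset.sum_congr rfl fun i _ => Nat.sub_add_cancel (hWle i)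
  have card_le : Fintype.card V ≤ ∑ j ∈ Z, (T j).verts.ncard + ∑ i, (W i).card := by
    have hcover : (Finset.univ : Finset V) ⊆
        (Z.biUnion fun j => (T j).verts.toFinset) ∪ Finset.univ.biUnion W := by
      intro v _
      simpa [hZ] using hall v
    calc Fintype.card V
        ≤ ((Z.biUnion fun j => (T j).verts.toFinset) ∪ Finset.univ.biUnion W).card :=
          Finset.card_le_card hcover
      _ ≤ _ := Finset.card_union_le _ _
      _ ≤ _ := by
          refine add_le_add ?_ Finset.card_biUnion_le
          simpa only [Set.ncard_eq_toFinset_card'] using Finset.card_biUnion_le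
  have assigned_ge : ∑ j ∈ Z, (T j).verts.ncard ≤
      ∑ j ∈ B, ∑ j' ∈ asg j, (T j').verts.ncard := by
    rw [← Finset.sum_biUnion]
    · refine Finset.sum_le_sum_of_subset fun j' hj' => ?_
      obtain ⟨j, hj, hmem⟩ := hasgall j' (by simpa [hZ] using hj')
      exact Finset.mem_biUnion.2 ⟨j, by simpa [hB] using hj, hmem⟩
    · intro j hj j' hj' hne
      exact hasgdisj j j' hne (by simpa [hB] using hj) (by simpa [hB] using hj')
  obtain ⟨j, hj, hle⟩ := Finset.exists_le_of_sum_le hBne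
    (f := fun j => ∑ i with c i ∈ (T j).verts, d i)
    (g := fun j => ∑ j' ∈ asg j, (T j').verts.ncard) (by lia)
  exact ⟨j, by simpa [hB] using hj, Finset.univ.filter fun i => c i ∈ (T j).verts, by simp,
    hle.trans (Nat.le_add_left _ _)⟩
end

section
/- Let G = (A ∪ B, E) be a convex bipartite graph with convex ordering a_1 < … < a_ℓ of A, and let P be an induced path in G from a_1 to a_ℓ. Then the vertices of A appearing on P appear in strictly increasing order of the convex ordering along the path: if a_{i_1}, a_{i_2}, …, a_{i_q} is the sequence of A-vertices of P in the order they appear on the path starting from a_1, then i_1 < i_2 < … < i_q. -/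
namespace SimpleGraph.Walk

variable {V : Type*} {G : SimpleGraph V} {u v : V} {P : G.Walk u v}

/-- On an induced path, adjacent vertices occupy consecutive positions. -/
lemma IsPath.succ_eq_or_eq_succ_of_adj_getVert (hP : P.IsPath)
    (hind : ∀ x ∈ P.support, ∀ y ∈ P.support, G.Adj x y → s(x, y) ∈ P.edges)
    {m n : ℕ} (hm : m ≤ P.length) (hn : n ≤ P.length)
    (hadj : G.Adj (P.getVert m) (P.getVert n)) : m + 1 = n ∨ m = n + 1 := by
  obtain ⟨i, hi, he⟩ := P.mk_mem_edges_iff_exists.1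
    (hind _ (P.getVert_mem_support m) _ (P.getVert_mem_support n) hadj)
  have inj : ∀ {r s : ℕ}, r ≤ P.length → s ≤ P.length → P.getVert r = P.getVert s → r = s :=
    fun hr hs h => hP.getVert_injOn hr hs h
  rcases Sym2.eq_iff.1 he with ⟨h₁, h₂⟩ | ⟨h₁, h₂⟩
  · have := inj (by omega) hm h₁
    have := inj (by omega) hn h₂
    omega
  · have := inj (by omega) hn h₁
    have := inj (by omega) hm h₂
    omega

/-- A walk in a bipartite graph that starts in the part `A` is in `A` exactly at the even
positions. -/
lemma getVert_mem_iff_even {A B : Set V} (hdisj : Disjoint A B)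
    (hbip : ∀ u v : V, G.Adj u v → (u ∈ A ∧ v ∈ B) ∨ (u ∈ B ∧ v ∈ A)) (hu : u ∈ A)
    {n : ℕ} (hn : n ≤ P.length) : P.getVert n ∈ A ↔ Even n := by
  induction n with
  | zero => simpa using hu
  | succ n ih =>
    have hAB : ∀ {x}, x ∈ A → x ∉ B := fun h => Set.disjoint_left.1 hdisj h
    rw [Nat.even_add_one, ← ih (by omega)]
    have := hbip _ _ (P.adj_getVert_succ (i := n) (by omega))
    grind

end SimpleGraph.Walk

/-- In a convex bipartite graph with convex ordering `a 0 < … < a (l-1)` of `A`, the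
`A`-vertices of an induced path from `a 0` to `a (l-1)` appear along the path in strictly
increasing order of the convex ordering. -/
theorem induced_path_A_vertices_monotone {V : Type} [Fintype V] [DecidableEq V]
    (G : SimpleGraph V)
    (A B : Set V) (hcover : A ∪ B = Set.univ) (hdisj : Disjoint A B)
    (hbip : ∀ u v : V, G.Adj u v → (u ∈ A ∧ v ∈ B) ∨ (u ∈ B ∧ v ∈ A))
    (l : ℕ) (hl : 0 < l)
    (a : Fin l → V) (ha : Function.Injective a) (hrange : Set.range a = A)
    (hconv : ∀ b ∈ B, ∀ i j r : Fin l, i ≤ j → j ≤ r →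
      G.Adj (a i) b → G.Adj (a r) b → G.Adj (a j) b)
    (P : G.Walk (a ⟨0, hl⟩) (a ⟨l - 1, Nat.sub_lt hl Nat.one_pos⟩))
    (hP : P.IsPath)
    (hind : ∀ x ∈ P.support, ∀ y ∈ P.support, G.Adj x y → s(x, y) ∈ P.edges) :
    ∀ p q : Fin P.support.length, p < q →
      ∀ i j : Fin l, P.support.get p = a i → P.support.get q = a j → i < j := by
  have ha₀ : a ⟨0, hl⟩ ∈ A := hrange ▸ Set.mem_range_self _
  have hA : ∀ {n}, n ≤ P.length → (P.getVert n ∈ A ↔ Even n) :=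
    fun hn => SimpleGraph.Walk.getVert_mem_iff_even hdisj hbip ha₀ hn
  have key : ∀ k n, 2 * k < n → n ≤ P.length → ∀ i j : Fin l,
      P.getVert (2 * k) = a i → P.getVert n = a j → i < j := by
    intro k
    induction k with
    | zero =>
      intro n hn hle i j hi hj
      have hi₀ : i = ⟨0, hl⟩ := ha (by simpa using hi.symm)
      have hij : i ≠ j := by
        rintro rfl
        have := hP.getVert_injOn (show 2 * 0 ≤ P.length by omega) hle (hi.trans hj.symm)
        omega
      exact lt_of_le_of_ne (hi₀ ▸ Nat.zero_le _) hij
    | succ k ih =>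
      intro n hn hle i j hi hj
      obtain ⟨r, hr⟩ : P.getVert (2 * k) ∈ Set.range a := by
        rw [hrange, hA (by omega)]
        exact even_two_mul k
      have hrj : r < j := ih n (by omega) hle r j hr.symm hj
      by_contra! hji
      have hb : P.getVert (2 * k + 1) ∈ B := by
        have : P.getVert (2 * k + 1) ∈ A ∪ B := hcover ▸ Set.mem_univ _
        refine this.resolve_left fun h => ?_
        rw [hA (by omega)] at h
        exact Nat.not_even_two_mul_add_one k h
      have hadj := hconv _ hb r j i hrj.le hji
        (hr ▸ P.adj_getVert_succ (by omega))
        (hi ▸ (P.adj_getVert_succ (i := 2 * k + 1) (by omega)).symm)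
      rw [← hj] at hadj
      have := hP.succ_eq_or_eq_succ_of_adj_getVert hind hle (by omega) hadj
      omega
  intro p q hpq i j hi hj
  have hlen := P.length_support
  have hget : ∀ r : Fin P.support.length, P.support.get r = P.getVert r :=
    fun r => P.support_getElem_eq_getVert _
  rw [hget] at hi hj
  obtain ⟨k, hk⟩ := even_iff_exists_two_mul.1
    ((hA (n := p) (by omega)).1 (hi ▸ hrange ▸ Set.mem_range_self i))
  exact key k q (by omega) (by omega) i j (hk ▸ hi) hj
end

section
/- Let G = (A ∪ B, E) be a 4k-connected convex bipartite graph with convex ordering a_1 < … < a_ℓ of A, and let P be an induced path in G from a_1 to a_ℓ. Then every set of 4k consecutive vertices of A (with respect to the convex ordering) contains at most 3 vertices of P. -/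
/-- A graph `G` is `k`-connected: it has more than `k` vertices and deleting any
set of fewer than `k` vertices leaves a connected graph. -/
def KConnected {V : Type} [Fintype V] (G : SimpleGraph V) (k : ℕ) : Prop :=
  k < Fintype.card V ∧
    ∀ S : Finset V, S.card < k → (G.induce ((↑S : Set V)ᶜ)).Connected

/-- Two vertices joined to the same vertex by edges of a path: among any three of them,
two coincide. -/
theorem SimpleGraph.Walk.IsPath.eq_or_eq_or_eq_of_mem_edges {V : Type*} {G : SimpleGraph V}
    {u v : V} {P : G.Walk u v} (hP : P.IsPath) {b x y z : V} (hx : s(b, x) ∈ P.edges)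
    (hy : s(b, y) ∈ P.edges) (hz : s(b, z) ∈ P.edges) : x = y ∨ y = z ∨ x = z := by
  have key : ∀ w, s(b, w) ∈ P.edges → ∃ i j, i ≤ P.length ∧ P.getVert i = b ∧
      P.getVert j = w ∧ (j = i + 1 ∨ i = j + 1) := by
    intro w hw
    obtain ⟨n, hn, he⟩ := P.mk_mem_edges_iff_exists.1 hw
    rcases Sym2.eq_iff.1 he with ⟨h, h'⟩ | ⟨h, h'⟩
    · exact ⟨n, n + 1, hn.le, h, h', .inl rfl⟩
    · exact ⟨n + 1, n, hn, h', h, .inr rfl⟩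
  obtain ⟨i, j, hi, hib, hj, h⟩ := key x hx
  obtain ⟨i', j', hi', hib', hj', h'⟩ := key y hy
  obtain ⟨i'', j'', hi'', hib'', hj'', h''⟩ := key z hz
  obtain rfl : i = i' := hP.getVert_injOn hi hi' (hib.trans hib'.symm)
  obtain rfl : i = i'' := hP.getVert_injOn hi hi'' (hib.trans hib''.symm)
  have : j = j' ∨ j' = j'' ∨ j = j'' := by omega
  subst hj hj' hj''
  rcases this with rfl | rfl | rfl <;> simp

/-- In a `k`-connected graph the neighbors of a vertex are not all contained in a set of
fewer than `k` vertices, as long as another vertex avoids that set. -/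
theorem KConnected.exists_adj_notMem {V : Type} [Fintype V] {G : SimpleGraph V} {k : ℕ}
    (hG : KConnected G k) {S : Finset V} (hS : S.card < k) {b c : V} (hb : b ∉ S)
    (hc : c ∉ S) (hbc : b ≠ c) : ∃ d, G.Adj b d ∧ d ∉ S := by
  obtain ⟨w⟩ := (hG.2 S hS).preconnected ⟨b, by simpa using hb⟩ ⟨c, by simpa using hc⟩
  cases w with
  | nil => exact absurd rfl hbc
  | @cons _ d _ h _ => exact ⟨d, h, d.2⟩

/-- In a `4k`-connected convex bipartite graph with convex ordering `a 0 < … < a (l-1)`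
of `A`, every set of `4k` consecutive vertices of `A` contains at most `3` vertices of a
given induced path from `a 0` to `a (l-1)`. -/
theorem induced_path_few_vertices_in_window {V : Type} [Fintype V] [DecidableEq V]
    (G : SimpleGraph V) (k : ℕ)
    (A B : Set V) (hcover : A ∪ B = Set.univ) (hdisj : Disjoint A B)
    (hbip : ∀ u v : V, G.Adj u v → (u ∈ A ∧ v ∈ B) ∨ (u ∈ B ∧ v ∈ A))
    (l : ℕ) (hl : 0 < l)
    (a : Fin l → V) (ha : Function.Injective a) (hrange : Set.range a = A)
    (hconv : ∀ b ∈ B, ∀ i j r : Fin l, i ≤ j → j ≤ r →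
      G.Adj (a i) b → G.Adj (a r) b → G.Adj (a j) b)
    (hconn : KConnected G (4 * k))
    (P : G.Walk (a ⟨0, hl⟩) (a ⟨l - 1, Nat.sub_lt hl Nat.one_pos⟩))
    (hP : P.IsPath)
    (hind : ∀ x ∈ P.support, ∀ y ∈ P.support, G.Adj x y → s(x, y) ∈ P.edges) :
    ∀ s : ℕ,
      (Finset.univ.filter fun r : Fin l =>
        s ≤ (r : ℕ) ∧ (r : ℕ) < s + 4 * k ∧ a r ∈ P.support).card ≤ 3 := by
  intro s
  by_contra! hcard
  set F := Finset.univ.filter fun r : Fin l =>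
    s ≤ (r : ℕ) ∧ (r : ℕ) < s + 4 * k ∧ a r ∈ P.support with hF
  let e : Fin 4 ↪o Fin l := F.orderEmbOfCardLe hcard
  have hmem : ∀ i, s ≤ (e i : ℕ) ∧ (e i : ℕ) < s + 4 * k ∧ a (e i) ∈ P.support := fun i => by
    simpa [hF] using F.orderEmbOfCardLe_mem hcard i
  have h01 : e 0 < e 1 := e.strictMono (by decide)
  have h12 : e 1 < e 2 := e.strictMono (by decide)
  have h23 : e 2 < e 3 := e.strictMono (by decide)
  have hnotA : ∀ v, v ∈ B → v ∉ A := fun v hB hA => Set.disjoint_left.1 hdisj hA hB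
  have haA : ∀ i, a i ∈ A := fun i => hrange ▸ Set.mem_range_self i
  have hex : ∃ n, ∃ j, e 1 < j ∧ n ≤ P.length ∧ P.getVert n = a j :=
    ⟨P.length, _, lt_of_lt_of_le h12 (by rw [Fin.le_def]; have := (e 2).2; simp; omega),
      le_rfl, P.getVert_length⟩
  classical
  obtain ⟨q, hq, hlen, hqv⟩ := Nat.find_spec hex
  have hmin : ∀ m < Nat.find hex, ∀ j, P.getVert m = a j → j ≤ e 1 := fun m hm j hj => by
    by_contra! hlt
    exact Nat.find_min hex hm ⟨j, hlt, by omega, hj⟩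
  generalize Nat.find hex = n at *
  have hstart : n ≠ 0 := by
    rintro rfl
    rw [P.getVert_zero] at hqv
    have := ha hqv
    rw [← this, Fin.lt_def] at hq
    simp at hq
  obtain ⟨n, rfl⟩ := Nat.exists_eq_succ_of_ne_zero hstart
  have hadj := P.adj_getVert_succ (i := n) (by omega)
  have hbB : P.getVert n ∈ B := by
    rcases hbip _ _ hadj with h | h
    · exact absurd (hqv ▸ haA q) (hnotA _ h.2)
    · exact h.1
  have hn0 : n ≠ 0 := by
    rintro rfl
    rw [P.getVert_zero] at hbB
    exact hnotA _ hbB (haA _)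
  obtain ⟨n, rfl⟩ := Nat.exists_eq_succ_of_ne_zero hn0
  have hadj' := P.adj_getVert_succ (i := n) (by omega)
  have hpA : P.getVert n ∈ A := by
    rcases hbip _ _ hadj' with h | h
    · exact h.1
    · exact absurd h.2 (hnotA _ hbB)
  rw [← hrange] at hpA
  obtain ⟨p, hp⟩ := hpA
  have hp1 : p ≤ e 1 := hmin n (by omega) p hp.symm
  have hbS : P.getVert (n + 1) ∈ P.support := P.getVert_mem_support _
  have hpS : a p ∈ P.support := hp ▸ P.getVert_mem_support _
  have hqS : a q ∈ P.support := hqv ▸ P.getVert_mem_support _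
  simp only [Nat.succ_eq_add_one] at *
  rw [hqv] at hadj
  rw [← hp] at hadj'
  generalize P.getVert (n + 1) = b at *
  have hthree : ∀ x y z : Fin l, x < y → y < z → a x ∈ P.support → a y ∈ P.support →
      a z ∈ P.support → G.Adj (a x) b → G.Adj (a z) b → False := by
    intro x y z hxy hyz hx hy hz hxb hzb
    have hyb := hconv b hbB x y z hxy.le hyz.le hxb hzb
    rcases hP.eq_or_eq_or_eq_of_mem_edges (hind _ hbS _ hx hxb.symm)
      (hind _ hbS _ hy hyb.symm) (hind _ hbS _ hz hzb.symm) with h | h | h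
    · exact hxy.ne (ha h)
    · exact hyz.ne (ha h)
    · exact (hxy.trans hyz).ne (ha h)
  obtain rfl : p = e 1 := hp1.antisymm <| not_lt.1 fun h =>
    hthree p (e 1) q h hq hpS (hmem 1).2.2 hqS hadj' hadj.symm
  have hq2 : q ≤ e 2 := not_lt.1 fun h =>
    hthree (e 1) (e 2) q h12 h hpS (hmem 2).2.2 hqS hadj' hadj.symm
  have hS : ((Finset.Ioo (e 0) (e 3)).image a).card < 4 * k := by
    refine Finset.card_image_le.trans_lt ?_
    rw [Fin.card_Ioo]
    have := hmem 0
    have := hmem 3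
    omega
  obtain ⟨d, hbd, hd⟩ := hconn.exists_adj_notMem hS (b := b) (c := a (e 0))
    (fun h => by
      obtain ⟨i, -, rfl⟩ := Finset.mem_image.1 h
      exact hnotA _ hbB (haA i))
    (fun h => by
      obtain ⟨i, hi, h⟩ := Finset.mem_image.1 h
      exact (Finset.mem_Ioo.1 hi).1.ne (ha h).symm)
    (fun h => hnotA _ hbB (h ▸ haA _))
  have hdA : d ∈ A := by
    rcases hbip _ _ hbd with h | h
    · exact absurd h.1 (hnotA _ hbB)
    · exact h.2
  rw [← hrange] at hdA
  obtain ⟨t, rfl⟩ := hdA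
  refine hd (Finset.mem_image_of_mem a (Finset.mem_Ioo.2 ⟨?_, ?_⟩)) <;> by_contra! ht
  · have h0 := hconv b hbB t (e 0) q ht (h01.trans hq).le hbd.symm hadj.symm
    exact hthree (e 0) (e 1) q h01 hq (hmem 0).2.2 hpS hqS h0 hadj.symm
  · have h3 := hconv b hbB (e 1) (e 3) t (h12.trans h23).le ht hadj' hbd.symm
    exact hthree (e 1) q (e 3) hq (hq2.trans_lt h23) hpS hqS (hmem 3).2.2 hadj' h3
end

section
/- Let G = (A ∪ B, E) be a 4k-connected convex bipartite graph with convex ordering a_1 < … < a_ℓ of A, and let P_1, …, P_k be pairwise internally-vertex-disjoint induced paths in G from a_1 to a_ℓ. Let a_{j_1} < … < a_{j_t} be the vertices of A that lie on none of the paths P_1, …, P_k, and for each i ∈ {1,…,k} set S_i = { a_{j_r} : r ≡ i (mod k) }. Then for every i ∈ {1,…,k}, every vertex of B is adjacent to some vertex of S_i. -/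
namespace SimpleGraph.Walk

variable {V : Type*} {G : SimpleGraph V}

theorem IsPath.eq_of_mem_edges_start {u v x y : V} {p : G.Walk u v} (hp : p.IsPath)
    (hx : s(u, x) ∈ p.edges) (hy : s(u, y) ∈ p.edges) : x = y := by
  cases p with
  | nil => simp at hx
  | @cons _ w _ h q =>
    rw [cons_isPath_iff] at hp
    have key : ∀ z, s(u, z) ∈ (cons h q).edges → s(u, z) = s(u, w) := fun z hz => by
      rw [edges_cons, List.mem_cons] at hz
      exact hz.resolve_right fun hz => hp.2 (q.fst_mem_support_of_mem_edges hz)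
    exact Sym2.congr_right.1 ((key x hx).trans (key y hy).symm)

theorem IsPath.not_three_edges {u v c x y z : V} {p : G.Walk u v} (hp : p.IsPath)
    (hx : s(c, x) ∈ p.edges) (hy : s(c, y) ∈ p.edges) (hz : s(c, z) ∈ p.edges)
    (hxy : x ≠ y) (hxz : x ≠ z) (hyz : y ≠ z) : False := by
  induction p with
  | nil => simp at hx
  | @cons u w v h q ih =>
    by_cases hc : c = u
    · subst hc
      exact hxy (hp.eq_of_mem_edges_start hx hy)
    · rw [cons_isPath_iff] at hp
      have key : ∀ d, s(c, d) ∈ (cons h q).edges →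
          (c = w ∧ d = u) ∨ s(c, d) ∈ q.edges := fun d hd => by
        rw [edges_cons, List.mem_cons, Sym2.eq_iff] at hd
        tauto
      have start : ∀ d e, c = w → s(c, d) ∈ q.edges → s(c, e) ∈ q.edges → d = e := by
        rintro d e rfl hd he
        exact hp.1.eq_of_mem_edges_start hd he
      have := ih hp.1
      have := start x y
      have := start x z
      have := start y z
      rcases key x hx with h1 | h1 <;> rcases key y hy with h2 | h2 <;>
        rcases key z hz with h3 | h3 <;> grind

end SimpleGraph.Walk

theorem KConnected.le_card_of_forall_adj_mem {V : Type} [Fintype V]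
    {G : SimpleGraph V} {n : ℕ} (hG : KConnected G n) {b : V} {S : Finset V}
    (hb : b ∉ S) (hS : ∀ v, G.Adj b v → v ∈ S) : n ≤ S.card := by
  classical
  by_contra! hlt
  obtain ⟨w, hw⟩ : ∃ w, w ∉ insert b S := by
    by_contra! hall
    have h1 := Finset.card_insert_le b S
    rw [Finset.eq_univ_iff_forall.2 hall, Finset.card_univ] at h1
    have := hG.1
    omega
  rw [Finset.mem_insert, not_or] at hw
  obtain ⟨p⟩ := (hG.2 S hlt).preconnected ⟨b, by simpa using hb⟩ ⟨w, by simpa using hw.2⟩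
  cases p with
  | nil => exact hw.1 rfl
  | @cons _ v _ h q => exact v.2 (hS _ h)

/-- If `b` sees four indices `r₁ < r₂ < r₃ < r₄` of an induced path of a convex bipartite graph,
then some vertex of `B` on the path has all its neighbours strictly between `a r₁` and `a r₄`. -/
theorem exists_mem_nhds_between {V : Type} {G : SimpleGraph V} {A B : Set V}
    (hdisj : Disjoint A B)
    (hbip : ∀ u v : V, G.Adj u v → (u ∈ A ∧ v ∈ B) ∨ (u ∈ B ∧ v ∈ A))
    {l : ℕ} {a : Fin l → V} (ha : Function.Injective a) (hrange : Set.range a = A)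
    (hconv : ∀ b ∈ B, ∀ i j r : Fin l, i ≤ j → j ≤ r →
      G.Adj (a i) b → G.Adj (a r) b → G.Adj (a j) b)
    {s e : Fin l} {p : G.Walk (a s) (a e)} (hp : p.IsPath)
    (hind : ∀ x ∈ p.support, ∀ y ∈ p.support, G.Adj x y → s(x, y) ∈ p.edges)
    {r₁ r₂ r₃ r₄ : Fin l} (h12 : r₁ < r₂) (h23 : r₂ < r₃) (h34 : r₃ < r₄)
    (hs : s ≤ r₂) (he : r₂ < e)
    (h₁ : a r₁ ∈ p.support) (h₂ : a r₂ ∈ p.support)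
    (h₃ : a r₃ ∈ p.support) (h₄ : a r₄ ∈ p.support) :
    ∃ c ∈ B, ∀ r, G.Adj (a r) c → r₁ < r ∧ r < r₄ := by
  have hAB : ∀ j, a j ∉ B := fun j hj =>
    Set.disjoint_left.1 hdisj (hrange ▸ Set.mem_range_self j) hj
  obtain ⟨d, hd, hd1, hd2⟩ := p.exists_boundary_dart
    {v | (∃ j ≤ r₂, v = a j) ∨ (v ∈ B ∧ ∃ j ≤ r₂, G.Adj (a j) v)}
    (Or.inl ⟨s, hs, rfl⟩) (by
      rintro (⟨j, hj, hje⟩ | ⟨hB, -⟩)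
      · rw [ha hje] at he
        exact absurd hj (not_le.2 he)
      · exact hAB _ hB)
  have hc := p.dart_fst_mem_support_of_mem_darts hd
  have hq := p.dart_snd_mem_support_of_mem_darts hd
  have hadj := d.adj
  generalize d.fst = c at *
  generalize d.snd = w at *
  rcases hd1 with ⟨j, hj, rfl⟩ | ⟨hcB, j, hj, hjc⟩
  · rcases hbip _ _ hadj with h | h
    · exact absurd (Or.inr ⟨h.2, j, hj, hadj⟩) hd2
    · exact absurd h.1 (hAB _)
  · have hwA : w ∈ A := by
      rcases hbip _ _ hadj with h | h
      · exact absurd hcB (Set.disjoint_left.1 hdisj h.1)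
      · exact h.2
    rw [← hrange] at hwA
    obtain ⟨q, rfl⟩ := hwA
    have hq2 : r₂ < q := by
      by_contra! h
      exact hd2 (Or.inl ⟨q, h, rfl⟩)
    have three : ∀ x y z, x < y → y < z → a x ∈ p.support → a y ∈ p.support →
        a z ∈ p.support → G.Adj (a x) c → G.Adj (a y) c → G.Adj (a z) c → False :=
      fun x y z hxy hyz hx hy hz ax ay az =>
        hp.not_three_edges (hind _ hc _ hx ax.symm) (hind _ hc _ hy ay.symm)
          (hind _ hc _ hz az.symm) (ha.ne hxy.ne) (ha.ne (hxy.trans hyz).ne) (ha.ne hyz.ne)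
    have hr2 : G.Adj (a r₂) c := hconv c hcB j r₂ q hj hq2.le hjc hadj.symm
    have hq3 : q ≤ r₃ := by
      by_contra! h
      exact three r₂ r₃ q h23 h h₂ h₃ hq hr2
        (hconv c hcB r₂ r₃ q h23.le h.le hr2 hadj.symm) hadj.symm
    refine ⟨c, hcB, fun r hr => ⟨?_, ?_⟩⟩
    · by_contra! h
      exact three r₁ r₂ q h12 hq2 h₁ h₂ hq
        (hconv c hcB r r₁ r₂ h h12.le hr hr2) hr2 hadj.symm
    · by_contra! h
      exact three r₂ q r₄ hq2 (hq3.trans_lt h34) h₂ hq h₄ hr2 hadj.symm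
        (hconv c hcB r₂ r₄ r (h23.trans h34).le h hr2 hr)

/-- An order-convex set of at least `k` elements of `Fin t` meets every residue class mod `k`. -/
theorem Finset.exists_mod_eq_of_ordConnected {t k : ℕ} {U : Finset (Fin t)}
    (hU : (U : Set (Fin t)).OrdConnected) (hk : k ≤ U.card) (i : Fin k) :
    ∃ r ∈ U, (r : ℕ) % k = i := by
  have hi := i.2
  have hne : U.Nonempty := Finset.card_pos.1 (by omega)
  set m := U.min' hne with hm
  set M := U.max' hne with hM
  have hcard : U.card ≤ (M : ℕ) + 1 - m := by
    rw [← Fin.card_Icc]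
    exact Finset.card_le_card fun x hx =>
      Finset.mem_Icc.2 ⟨U.min'_le x hx, U.le_max' x hx⟩
  obtain ⟨n, hn1, hn2, hn3⟩ : ∃ n, (m : ℕ) ≤ n ∧ n < m + k ∧ n % k = i := by
    have hdm := Nat.div_add_mod (m : ℕ) k
    have hlt := Nat.mod_lt (m : ℕ) (show 0 < k by omega)
    by_cases h : (m : ℕ) % k ≤ i
    · exact ⟨k * (m / k) + i, by omega, by omega, by
        rw [Nat.mul_add_mod, Nat.mod_eq_of_lt hi]⟩
    · exact ⟨k * (m / k + 1) + i, by rw [mul_add]; omega, by rw [mul_add]; omega, by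
        rw [Nat.mul_add_mod, Nat.mod_eq_of_lt hi]⟩
  have hnM : n ≤ M := by omega
  exact ⟨⟨n, hnM.trans_lt M.2⟩, hU.out (U.min'_mem hne) (U.max'_mem hne) ⟨hn1, hnM⟩, hn3⟩

/-- In a `4k`-connected convex bipartite graph with convex ordering `a 0 < … < a (l-1)`
of `A`, given `k` pairwise internally-vertex-disjoint induced paths from `a 0` to
`a (l-1)`, let `J` (of cardinality `t`) be the set of indices of `A`-vertices lying on
none of the paths, enumerated in increasing order by `J.orderEmbOfFin ht`. Distributing
these vertices alternately, the `i`-th set `S_i = {a (J.orderEmbOfFin ht r) : r ≡ i (mod k)}`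
dominates `B`: every vertex of `B` is adjacent to some vertex of `S_i`. -/
theorem alternating_leftover_sets_dominate_B {V : Type} [Fintype V] [DecidableEq V]
    (G : SimpleGraph V) (k : ℕ)
    (A B : Set V) (hcover : A ∪ B = Set.univ) (hdisj : Disjoint A B)
    (hbip : ∀ u v : V, G.Adj u v → (u ∈ A ∧ v ∈ B) ∨ (u ∈ B ∧ v ∈ A))
    (l : ℕ) (hl : 0 < l)
    (a : Fin l → V) (ha : Function.Injective a) (hrange : Set.range a = A)
    (hconv : ∀ b ∈ B, ∀ i j r : Fin l, i ≤ j → j ≤ r →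
      G.Adj (a i) b → G.Adj (a r) b → G.Adj (a j) b)
    (hconn : KConnected G (4 * k))
    (P : Fin k → G.Walk (a ⟨0, hl⟩) (a ⟨l - 1, Nat.sub_lt hl Nat.one_pos⟩))
    (hP : ∀ i, (P i).IsPath)
    (hind : ∀ i, ∀ x ∈ (P i).support, ∀ y ∈ (P i).support,
      G.Adj x y → s(x, y) ∈ (P i).edges)
    (hintdisj : ∀ i j : Fin k, i ≠ j → ∀ v : V,
      v ∈ (P i).support → v ∈ (P j).support →
      v = a ⟨0, hl⟩ ∨ v = a ⟨l - 1, Nat.sub_lt hl Nat.one_pos⟩)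
    (J : Finset (Fin l)) (hJ : ∀ r : Fin l, r ∈ J ↔ ∀ i : Fin k, a r ∉ (P i).support)
    (t : ℕ) (ht : J.card = t) :
    ∀ i : Fin k, ∀ b ∈ B, ∃ r : Fin t,
      (r : ℕ) % k = (i : ℕ) ∧ G.Adj b (a (J.orderEmbOfFin ht r)) := by
  classical
  have hmemA : ∀ j, a j ∈ A := fun j => hrange ▸ Set.mem_range_self j
  have hdeg : ∀ b ∈ B, 4 * k ≤ (Finset.univ.filter fun r => G.Adj (a r) b).card := by
    intro b hb
    rw [← Finset.card_image_of_injective _ ha]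
    refine hconn.le_card_of_forall_adj_mem (b := b) ?_ fun v hv => ?_
    · intro h
      obtain ⟨r, -, rfl⟩ := Finset.mem_image.1 h
      exact Set.disjoint_left.1 hdisj (hmemA r) hb
    · have hvA : v ∈ A := by
        rcases hbip _ _ hv with h | h
        · exact absurd hb (Set.disjoint_left.1 hdisj h.1)
        · exact h.2
      rw [← hrange] at hvA
      obtain ⟨r, rfl⟩ := hvA
      exact Finset.mem_image_of_mem _ (by simpa using hv.symm)
  have hleft : ∀ n, ∀ b ∈ B, (Finset.univ.filter fun r => G.Adj (a r) b).card = n →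
      k ≤ (J.filter fun r => G.Adj (a r) b).card := by
    intro n
    induction n using Nat.strong_induction_on with
    | _ n ih =>
    intro b hb hn
    by_cases hbig : ∃ i, 4 ≤ (Finset.univ.filter fun r =>
        G.Adj (a r) b ∧ a r ∈ (P i).support).card
    · obtain ⟨i, hi⟩ := hbig
      set f := Finset.orderEmbOfCardLe _ hi with hf
      have hmem : ∀ x, G.Adj (a (f x)) b ∧ a (f x) ∈ (P i).support := fun x =>
        (Finset.mem_filter.1 (Finset.orderEmbOfCardLe_mem _ hi x)).2
      have h01 : f 0 < f 1 := f.strictMono (by decide)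
      have h12 : f 1 < f 2 := f.strictMono (by decide)
      have h23 : f 2 < f 3 := f.strictMono (by decide)
      obtain ⟨c, hc, hcb⟩ := exists_mem_nhds_between hdisj hbip ha hrange hconv (hP i) (hind i)
        h01 h12 h23 (Fin.mk_le_of_le_val (Nat.zero_le _))
        (Fin.lt_def.2 (by have := (f 2).2; have := Fin.lt_def.1 h12; simp only; omega))
        (hmem 0).2 (hmem 1).2 (hmem 2).2 (hmem 3).2
      have hsub : ∀ r, G.Adj (a r) c → G.Adj (a r) b := fun r hr =>
        hconv b hb (f 0) r (f 3) (hcb r hr).1.le (hcb r hr).2.le (hmem 0).1 (hmem 3).1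
      refine (ih _ ?_ c hc rfl).trans
        (Finset.card_le_card (Finset.monotone_filter_right J fun r _ => hsub r))
      rw [← hn]
      refine Finset.card_lt_card (Finset.ssubset_iff_of_subset
        (Finset.monotone_filter_right _ fun r _ => hsub r) |>.2 ⟨f 0, ?_, fun h => ?_⟩)
      · simpa using (hmem 0).1
      · exact lt_irrefl _ (hcb _ (Finset.mem_filter.1 h).2).1
    · push Not at hbig
      have hcov : (Finset.univ.filter fun r => G.Adj (a r) b) ⊆
          (J.filter fun r => G.Adj (a r) b) ∪ Finset.univ.biUnion fun i =>
            Finset.univ.filter fun r => G.Adj (a r) b ∧ a r ∈ (P i).support := by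
        intro r hr
        have hr' : G.Adj (a r) b := by simpa using hr
        by_cases hrJ : r ∈ J
        · simp [hrJ, hr']
        · rw [hJ] at hrJ
          push Not at hrJ
          simp [hrJ, hr']
      have h1 := (Finset.card_le_card hcov).trans (Finset.card_union_le _ _)
      have h2 := Finset.card_biUnion_le_card_mul Finset.univ
        (fun i => Finset.univ.filter fun r => G.Adj (a r) b ∧ a r ∈ (P i).support) 3
        fun i _ => Nat.le_of_lt_succ (hbig i)
      rw [Finset.card_fin] at h2
      have := hdeg b hb
      omega
  intro i b hb
  have hU : ((Finset.univ.filter fun s => G.Adj (a (J.orderEmbOfFin ht s)) b :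
      Finset (Fin t)) : Set (Fin t)).OrdConnected := by
    refine ⟨fun x hx y hy z hz => ?_⟩
    simp only [Finset.coe_filter, Finset.mem_univ, true_and, Set.mem_ofPred_eq] at hx hy ⊢
    exact hconv b hb _ _ _ ((J.orderEmbOfFin ht).monotone hz.1)
      ((J.orderEmbOfFin ht).monotone hz.2) hx hy
  have hcard : k ≤ (Finset.univ.filter fun s => G.Adj (a (J.orderEmbOfFin ht s)) b).card := by
    refine (hleft _ b hb rfl).trans ?_
    rw [← Finset.card_map (J.orderEmbOfFin ht).toEmbedding]
    refine Finset.card_le_card fun r hr => ?_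
    obtain ⟨hrJ, hr⟩ := Finset.mem_filter.1 hr
    obtain ⟨s, rfl⟩ : r ∈ Set.range (J.orderEmbOfFin ht) := by
      rwa [Finset.range_orderEmbOfFin]
    exact Finset.mem_map_of_mem _ (by simpa using hr)
  obtain ⟨r, hr, hri⟩ := Finset.exists_mod_eq_of_ordConnected hU hcard i
  exact ⟨r, hri, (Finset.mem_filter.1 hr).2.symm⟩
end

section
/- Let G = (A ∪ B, E) be a connected biconvex bipartite graph with biconvex orderings a_1 < … < a_n of A and b_1 < … < b_m of B. Let P' be an induced path in G from a_1 to a_n, let P be obtained from P' by deleting the endpoints a_1 and a_n, and let T = V(P) ∪ {a, a'} where a ∈ A is a neighbor of b_1 and a' ∈ A is a neighbor of b_m. Then T is a connected dominating set of G, i.e., G[T] is connected and every vertex of G is in T or adjacent to a vertex of T. -/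
namespace SimpleGraph

variable {V : Type*} {G : SimpleGraph V}

/-- A path between distinct nonadjacent vertices has a nonempty interior, which is traversed by
a walk. -/
theorem Walk.IsPath.exists_interior_walk {u v : V} {p : G.Walk u v} (hp : p.IsPath)
    (hne : u ≠ v) (hnadj : ¬ G.Adj u v) :
    ∃ (y z : V) (r : G.Walk y z), G.Adj u y ∧ G.Adj z v ∧
      ∀ w, w ∈ r.support ↔ w ∈ p.support ∧ w ≠ u ∧ w ≠ v := by
  cases p with
  | nil => exact absurd rfl hne
  | cons h q =>
    cases q with
    | nil => exact absurd h hnadj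
    | cons h₂ q =>
      obtain ⟨z, r, h₃, hr⟩ := Walk.exists_cons_eq_concat h₂ q
      rw [hr] at hp ⊢
      refine ⟨_, z, r, h, h₃, fun w => ?_⟩
      have hnodup := hp.support_nodup
      simp only [Walk.support_cons, Walk.support_concat,
        List.nodup_cons, List.nodup_append, List.mem_append, List.mem_cons,
        List.not_mem_nil] at hnodup ⊢
      grind

/-- In a bipartite graph with parts enumerated by `p` and `q`, such that every neighborhood of a
vertex `p i` is convex in the order of `q`, a connected set of vertices containing a neighbor of
the first vertex `q ⊥` and a neighbor of the last vertex `q ⊤` dominates every vertex `q j`. -/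
theorem Preconnected.mem_or_exists_adj_of_convex {ι κ : Type*} [LinearOrder κ] [BoundedOrder κ]
    {p : ι → V} {q : κ → V}
    (hbip : ∀ u v, G.Adj u v →
      (u ∈ Set.range p ∧ v ∈ Set.range q) ∨ (u ∈ Set.range q ∧ v ∈ Set.range p))
    (hdisj : Disjoint (Set.range p) (Set.range q))
    (hconv : ∀ i j₁ j₂ j₃, j₁ ≤ j₂ → j₂ ≤ j₃ →
      G.Adj (p i) (q j₁) → G.Adj (p i) (q j₃) → G.Adj (p i) (q j₂))
    {T : Set V} (hT : (G.induce T).Preconnected) {x x' : V} (hx : x ∈ T) (hx' : x' ∈ T)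
    (hxq : G.Adj x (q ⊥)) (hxq' : G.Adj x' (q ⊤)) (j : κ) :
    q j ∈ T ∨ ∃ u ∈ T, G.Adj (q j) u := by
  by_contra! hj
  obtain ⟨hjT, hj⟩ := hj
  have hpq : ∀ i k, p i ≠ q k := fun i k h =>
    Set.disjoint_left.1 hdisj ⟨i, rfl⟩ (h ▸ ⟨k, rfl⟩)
  have adj_right : ∀ u k, G.Adj u (q k) → ∃ i, p i = u := by
    intro u k h
    rcases hbip _ _ h with ⟨hu, -⟩ | ⟨-, i, hi⟩
    · exact hu
    · exact absurd hi (hpq i k)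
  let below : V → Prop := fun v => ∃ k < j, v = q k ∨ G.Adj v (q k)
  have step : ∀ u v, u ∈ T → v ∈ T → G.Adj u v → below u → below v := by
    rintro u v hu hv huv ⟨k, hk, rfl | huk⟩
    · exact ⟨k, hk, Or.inr huv.symm⟩
    · obtain ⟨i, rfl⟩ := adj_right _ _ huk
      rcases hbip _ _ huv with ⟨-, l, rfl⟩ | ⟨⟨l, hl⟩, -⟩
      · refine ⟨l, lt_of_not_ge fun hjl => ?_, Or.inl rfl⟩
        exact hj _ hu (hconv i k j l hk.le hjl huk huv).symm
      · exact absurd hl.symm (hpq i l)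
  have walk : ∀ (u v : T), (G.induce T).Walk u v → below u → below v := by
    intro u v w
    induction w with
    | nil => exact id
    | cons h _ ih => exact fun hu => ih (step _ _ (Subtype.prop _) (Subtype.prop _) h hu)
  have hbot : ⊥ < j := bot_lt_iff_ne_bot.2 fun h => hj x hx (h ▸ hxq.symm)
  obtain ⟨w⟩ := hT ⟨x, hx⟩ ⟨x', hx'⟩
  obtain ⟨i, rfl⟩ := adj_right _ _ hxq'
  obtain ⟨k, hk, h | h⟩ := walk _ _ w ⟨⊥, hbot, Or.inr hxq⟩
  · exact hpq i k h
  · exact hj _ hx' (hconv i k j ⊤ hk.le le_top h hxq').symm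

/-- Adding to a connected set a vertex that it contains or dominates keeps it connected. -/
theorem Connected.induce_insert {S : Set V} (hS : (G.induce S).Connected) {x : V}
    (hx : x ∈ S ∨ ∃ u ∈ S, G.Adj x u) : (G.induce (insert x S)).Connected := by
  rcases hx with hx | ⟨u, hu, hxu⟩
  · rwa [Set.insert_eq_of_mem hx]
  · have hpair : (G.induce {x, u}).Connected := induce_pair_connected_of_adj hxu
    have hunion := induce_union_connected hpair.preconnected hS.preconnected ⟨u, by simp, hu⟩
    rwa [show ({x, u} : Set V) ∪ S = insert x S by
      rw [Set.insert_union, Set.singleton_union, Set.insert_eq_of_mem hu]] at hunion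

end SimpleGraph

/-- `D` is a connected dominating set of `G`. -/
def IsCDS {V : Type} (G : SimpleGraph V) (D : Set V) : Prop :=
  (G.induce D).Connected ∧ ∀ v : V, v ∈ D ∨ ∃ u ∈ D, G.Adj v u

/-- In a connected biconvex bipartite graph with biconvex orderings `a 0 < … < a (n-1)`
of `A` and `b 0 < … < b (m-1)` of `B`, if `P'` is an induced path from `a 0` to
`a (n-1)`, `P` is obtained from `P'` by deleting the two endpoints, and
`T = V(P) ∪ {x, x'}` where `x ∈ A` is a neighbour of `b 0` and `x' ∈ A` is a neighbour
of `b (m-1)`, then `T` is a connected dominating set of `G`. -/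
theorem biconvex_trimmed_path_plus_two_is_CDS {V : Type} [Fintype V] [DecidableEq V]
    (G : SimpleGraph V) (hGconn : G.Connected)
    (A B : Set V) (hcover : A ∪ B = Set.univ) (hdisj : Disjoint A B)
    (hbip : ∀ u v : V, G.Adj u v → (u ∈ A ∧ v ∈ B) ∨ (u ∈ B ∧ v ∈ A))
    (n m : ℕ) (hn : 0 < n) (hm : 0 < m)
    (a : Fin n → V) (ha : Function.Injective a) (hrangeA : Set.range a = A)
    (b : Fin m → V) (hb : Function.Injective b) (hrangeB : Set.range b = B)
    (hconvA : ∀ j : Fin m, ∀ i₁ i₂ i₃ : Fin n, i₁ ≤ i₂ → i₂ ≤ i₃ →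
      G.Adj (a i₁) (b j) → G.Adj (a i₃) (b j) → G.Adj (a i₂) (b j))
    (hconvB : ∀ i : Fin n, ∀ j₁ j₂ j₃ : Fin m, j₁ ≤ j₂ → j₂ ≤ j₃ →
      G.Adj (a i) (b j₁) → G.Adj (a i) (b j₃) → G.Adj (a i) (b j₂))
    (P' : G.Walk (a ⟨0, hn⟩) (a ⟨n - 1, Nat.sub_lt hn Nat.one_pos⟩))
    (hP' : P'.IsPath)
    (hind : ∀ x ∈ P'.support, ∀ y ∈ P'.support, G.Adj x y → s(x, y) ∈ P'.edges)
    (S : Set V)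
    (hS : S = {v | v ∈ P'.support ∧ v ≠ a ⟨0, hn⟩ ∧ v ≠ a ⟨n - 1, Nat.sub_lt hn Nat.one_pos⟩})
    (x x' : V) (hx : x ∈ A) (hxb : G.Adj x (b ⟨0, hm⟩))
    (hx' : x' ∈ A) (hxb' : G.Adj x' (b ⟨m - 1, Nat.sub_lt hm Nat.one_pos⟩)) :
    IsCDS G (S ∪ {x, x'}) := by
  subst hrangeA hrangeB
  have : NeZero n := ⟨hn.ne'⟩
  have : NeZero m := ⟨hm.ne'⟩
  have domB : ∀ T : Set V, (G.induce T).Preconnected → x ∈ T → x' ∈ T →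
      ∀ j, b j ∈ T ∨ ∃ u ∈ T, G.Adj (b j) u := fun T hT h h' =>
    hT.mem_or_exists_adj_of_convex hbip hdisj hconvB h h' hxb hxb'
  have hcases : ∀ v, v ∈ Set.range a ∨ v ∈ Set.range b := fun v =>
    (Set.mem_union _ _ _).1 (hcover ▸ Set.mem_univ v)
  suffices h : (G.induce (S ∪ {x, x'})).Connected ∧
      ∀ i, a i ∈ S ∪ {x, x'} ∨ ∃ u ∈ S ∪ {x, x'}, G.Adj (a i) u by
    refine ⟨h.1, fun v => ?_⟩
    rcases hcases v with ⟨i, rfl⟩ | ⟨j, rfl⟩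
    · exact h.2 i
    · exact domB _ h.1.preconnected (by simp) (by simp) j
  rcases Nat.eq_or_lt_of_le (Nat.succ_le_of_lt hn) with h1 | h1
  · obtain rfl : n = 1 := h1.symm
    obtain ⟨i, rfl⟩ := hx
    obtain ⟨i', rfl⟩ := hx'
    obtain rfl : i = i' := Subsingleton.elim _ _
    have hSempty : S = ∅ := by
      rw [hS, Set.eq_empty_iff_forall_notMem]
      rintro v ⟨hv, hv', -⟩
      rw [SimpleGraph.Walk.nil_iff_support_eq.1 (hP'.nil_iff_eq.2 rfl)] at hv
      exact hv' (by simpa using hv)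
    rw [hSempty, Set.empty_union, Set.pair_eq_singleton]
    refine ⟨by simp, fun k => Or.inl ?_⟩
    rw [Subsingleton.elim k i]
    rfl
  · have hne : a ⟨0, hn⟩ ≠ a ⟨n - 1, Nat.sub_lt hn Nat.one_pos⟩ := fun h => by
      have := congrArg Fin.val (ha h)
      simp at this
      omega
    have hnadj : ¬ G.Adj (a ⟨0, hn⟩) (a ⟨n - 1, Nat.sub_lt hn Nat.one_pos⟩) := fun h => by
      rcases hbip _ _ h with ⟨-, h⟩ | ⟨h, -⟩ <;>
        exact Set.disjoint_left.1 hdisj ⟨_, rfl⟩ h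
    obtain ⟨y, z, r, hy, hz, hr⟩ := hP'.exists_interior_walk hne hnadj
    have hSr : S = {v | v ∈ r.support} := by
      rw [hS]; ext v; exact (hr v).symm
    have hSconn : (G.induce S).Connected := hSr ▸ r.connected_induce_support
    have domA : ∀ i, a i ∈ S ∨ ∃ u ∈ S, G.Adj (a i) u :=
      hSconn.preconnected.mem_or_exists_adj_of_convex (fun u v h => (hbip u v h).symm)
        hdisj.symm (fun j i₁ i₂ i₃ h₁ h₂ h h' => (hconvA j i₁ i₂ i₃ h₁ h₂ h.symm h'.symm).symm)
        (hSr ▸ r.start_mem_support) (hSr ▸ r.end_mem_support) hy.symm hz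
    have weaken : ∀ (T : Set V), S ⊆ T → ∀ v, (v ∈ S ∨ ∃ u ∈ S, G.Adj v u) →
        v ∈ T ∨ ∃ u ∈ T, G.Adj v u := fun T hT v =>
      Or.imp (@hT v) fun ⟨u, hu, h⟩ => ⟨u, hT hu, h⟩
    obtain ⟨i, rfl⟩ := hx
    obtain ⟨i', rfl⟩ := hx'
    refine ⟨?_, fun k => weaken _ Set.subset_union_left _ (domA k)⟩
    have hconn := (hSconn.induce_insert (domA i')).induce_insert
      (weaken _ (Set.subset_insert _ _) _ (domA i))
    rwa [Set.union_comm, Set.insert_union, Set.singleton_union]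
end

section
/- Let G be a graph with a path decomposition B_1, …, B_ℓ in which every bag B_i induces a clique in G. Then for every path P in G from a vertex of B_1 to a vertex of B_ℓ, the vertex set of P is a dominating set of G: every vertex of G is on P or adjacent to a vertex of P. -/
/-- In a path decomposition, a walk from a vertex of bag `i` to a vertex of bag `k` meets every
bag between `i` and `k`. -/
theorem SimpleGraph.Walk.exists_mem_support_mem_bag {V ι : Type*} [LinearOrder ι]
    {G : SimpleGraph V} {Bg : ι → Set V}
    (hedge : ∀ u v : V, G.Adj u v → ∃ i, u ∈ Bg i ∧ v ∈ Bg i)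
    (hcont : ∀ v : V, ∀ i j r : ι, i ≤ j → j ≤ r → v ∈ Bg i → v ∈ Bg r → v ∈ Bg j)
    {u v : V} (P : G.Walk u v) {i j k : ι} (hij : i ≤ j) (hjk : j ≤ k)
    (hu : u ∈ Bg i) (hv : v ∈ Bg k) : ∃ x ∈ P.support, x ∈ Bg j := by
  induction P generalizing i with
  | nil => exact ⟨_, by simp, hcont _ i j k hij hjk hu hv⟩
  | cons h p ih =>
    obtain ⟨m, hum, hwm⟩ := hedge _ _ h
    rcases le_total j m with hjm | hmj
    · exact ⟨_, SimpleGraph.Walk.start_mem_support _, hcont _ i j m hij hjm hu hum⟩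
    · obtain ⟨x, hx, hxj⟩ := ih hmj hwm hv
      exact ⟨x, by simp [hx], hxj⟩

/-- If `G` has a path decomposition `Bg 0, …, Bg (l-1)` in which every bag induces a
clique, then the vertex set of any path from a vertex of the first bag to a vertex of
the last bag dominates `G`. -/
theorem path_dominates_of_clique_path_decomposition {V : Type} [Fintype V] [DecidableEq V]
    (G : SimpleGraph V) (l : ℕ) (hl : 0 < l)
    (Bg : Fin l → Set V)
    (hcover : (⋃ i, Bg i) = Set.univ)
    (hedge : ∀ u v : V, G.Adj u v → ∃ i, u ∈ Bg i ∧ v ∈ Bg i)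
    (hcont : ∀ v : V, ∀ i j r : Fin l, i ≤ j → j ≤ r → v ∈ Bg i → v ∈ Bg r → v ∈ Bg j)
    (hclique : ∀ i : Fin l, ∀ u ∈ Bg i, ∀ v ∈ Bg i, u ≠ v → G.Adj u v)
    (u v : V) (hu : u ∈ Bg ⟨0, hl⟩) (hv : v ∈ Bg ⟨l - 1, Nat.sub_lt hl Nat.one_pos⟩)
    (P : G.Walk u v) (hP : P.IsPath) :
    ∀ w : V, w ∈ P.support ∨ ∃ x ∈ P.support, G.Adj w x := by
  intro w
  obtain ⟨j, hwj⟩ := Set.mem_iUnion.mp (hcover ▸ Set.mem_univ w)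
  obtain ⟨x, hxP, hxj⟩ := P.exists_mem_support_mem_bag hedge hcont (j := j)
    (Fin.mk_le_of_le_val (Nat.zero_le _)) (Fin.le_def.mpr (Nat.le_sub_one_of_lt j.isLt)) hu hv
  by_cases hwx : w = x
  · exact Or.inl (hwx ▸ hxP)
  · exact Or.inr ⟨x, hxP, hclique j w hwj x hxj hwx⟩
end

section
/- Every k-connected interval graph G contains k pairwise vertex-disjoint paths P_1, …, P_k such that the vertex set of each P_i is a dominating set of G; in particular, each V(P_i) is a connected dominating set of G. -/
/-- `G` is an interval graph. -/
def IsIntervalGraph {V : Type} (G : SimpleGraph V) : Prop :=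
  ∃ lo hi : V → ℝ, (∀ v, lo v ≤ hi v) ∧
    ∀ u v : V, u ≠ v →
      (G.Adj u v ↔ (Set.Icc (lo u) (hi u) ∩ Set.Icc (lo v) (hi v)).Nonempty)

namespace IntervalSweep

variable {V : Type}

/-- The state of the left-to-right sweep: disjoint paths with vertex sets `used i`, each ending
in `last i` and covering the line from `a` to `hi (last i)`, such that every vertex which is not
the end of its path has its right endpoint behind all the current ends. -/
structure SweepState (G : SimpleGraph V) (lo hi : V → ℝ) (a : ℝ) {k : ℕ}
    (last : Fin k → V) (used : Fin k → Finset V) : Prop where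
  path : ∀ i, ∃ (u : V) (p : G.Walk (last i) u), p.IsPath ∧ ∀ x, x ∈ p.support ↔ x ∈ used i
  disjoint : ∀ i j, i ≠ j → ∀ x ∈ used i, x ∉ used j
  behind : ∀ i, ∀ x ∈ used i, x ≠ last i → ∀ j, hi x ≤ hi (last j)
  cover : ∀ i t, a ≤ t → t ≤ hi (last i) → ∃ x ∈ used i, lo x ≤ t ∧ t ≤ hi x

variable {G : SimpleGraph V} {lo hi : V → ℝ} {k : ℕ}

/-- In a `k`-connected interval graph, at least `k` intervals contain a right neighbourhood of
every point `r` that has an interval on either side. -/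
theorem le_card_crossing [Fintype V] [DecidableEq V]
    (hG : ∀ u v : V, u ≠ v →
      (G.Adj u v ↔ (Set.Icc (lo u) (hi u) ∩ Set.Icc (lo v) (hi v)).Nonempty))
    (hconn : KConnected G k) {A B : V} {r : ℝ} (hA : hi A ≤ r) (hB : r < lo B)
    (hle : ∀ v, lo v ≤ hi v) :
    k ≤ (Finset.univ.filter fun v => lo v ≤ r ∧ r < hi v).card := by
  by_contra! hlt
  have hc := hconn.2 _ hlt
  have hAm : A ∈ ((↑(Finset.univ.filter fun v => lo v ≤ r ∧ r < hi v) : Set V)ᶜ) := by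
    simpa using fun _ => hA
  have hBm : B ∈ ((↑(Finset.univ.filter fun v => lo v ≤ r ∧ r < hi v) : Set V)ᶜ) := by
    simpa using fun h => absurd hB h.not_gt
  obtain ⟨p⟩ := hc.preconnected ⟨A, hAm⟩ ⟨B, hBm⟩
  obtain ⟨d, -, hd1, hd2⟩ := p.exists_boundary_dart {x | hi x.1 ≤ r} hA
    (not_le.2 (hB.trans_le (hle B)))
  obtain ⟨⟨⟨x, hx⟩, ⟨y, hy⟩⟩, hxy⟩ := d
  have hadj : G.Adj x y := hxy
  obtain ⟨t, ht1, ht2⟩ := (hG x y hadj.ne).1 hadj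
  simp only [Set.mem_ofPred_eq, not_le, Set.mem_Icc] at hd1 hd2 ht1 ht2
  refine hy ?_
  simp only [Finset.coe_filter, Finset.mem_univ, true_and, Set.mem_ofPred_eq]
  exact ⟨by linarith, hd2⟩

/-- Some path of an unfinished sweep can be extended by an unused vertex. -/
theorem SweepState.extend [Fintype V] [DecidableEq V]
    (hG : ∀ u v : V, u ≠ v →
      (G.Adj u v ↔ (Set.Icc (lo u) (hi u) ∩ Set.Icc (lo v) (hi v)).Nonempty))
    (hconn : KConnected G k) (hle : ∀ v, lo v ≤ hi v) {A B : V} (hA : ∀ v, hi A ≤ hi v)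
    {last : Fin k → V} {used : Fin k → Finset V}
    (hs : SweepState G lo hi (hi A) last used) {j : Fin k} (hj : hi (last j) < lo B) :
    ∃ (last' : Fin k → V) (used' : Fin k → Finset V),
      SweepState G lo hi (hi A) last' used' ∧ ∑ i, (used i).card < ∑ i, (used' i).card := by
  have : Nonempty (Fin k) := ⟨j⟩
  obtain ⟨i, hmin⟩ := Finite.exists_min fun i => hi (last i)
  have hcard := le_card_crossing hG hconn (hA (last i)) ((hmin j).trans_lt hj) hle
  have hlast : ((Finset.univ.erase i).image last).card < k := by
    refine Finset.card_image_le.trans_lt ?_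
    simpa using Nat.sub_lt i.pos one_pos
  obtain ⟨x, hx, hxl⟩ := Finset.exists_mem_notMem_of_card_lt_card (hlast.trans_le hcard)
  simp only [Finset.mem_filter, Finset.mem_univ, true_and] at hx
  have hunused : ∀ m, x ∉ used m := by
    intro m hm
    by_cases h : x = last m
    · by_cases hmi : m = i
      · subst hmi; rw [h] at hx; exact lt_irrefl _ hx.2
      · exact hxl (Finset.mem_image.2 ⟨m, by simp [hmi], h.symm⟩)
    · exact absurd (hs.behind m x hm h i) (not_le.2 hx.2)
  have hlast_mem : ∀ m, last m ∈ used m := fun m => by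
    obtain ⟨u, p, -, hp⟩ := hs.path m
    exact (hp _).1 p.start_mem_support
  have hne : x ≠ last i := fun h => hunused i (h ▸ hlast_mem i)
  have hadj : G.Adj x (last i) := (hG _ _ hne).2
    ⟨hi (last i), ⟨hx.1, hx.2.le⟩, ⟨hle _, le_rfl⟩⟩
  have hmono : ∀ m, hi (last i) ≤ hi (Function.update last i x m) := by
    intro m
    by_cases hm : m = i
    · subst hm; simpa using hx.2.le
    · simpa [hm] using hmin m
  refine ⟨Function.update last i x, Function.update used i (insert x (used i)),
    ⟨?_, ?_, ?_, ?_⟩, ?_⟩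
  · intro m
    by_cases hm : m = i
    · subst hm
      obtain ⟨u, p, hp, hps⟩ := hs.path m
      rw [Function.update_self, Function.update_self]
      refine ⟨u, p.cons hadj, hp.cons (fun h => hunused m ((hps x).1 h)), fun y => ?_⟩
      simp [hps]
    · rw [Function.update_of_ne hm, Function.update_of_ne hm]
      exact hs.path m
  · intro m n hmn y
    by_cases hm : m = i
    · subst hm
      rw [Function.update_self, Function.update_of_ne hmn.symm, Finset.mem_insert]
      rintro (rfl | hy)
      · exact hunused n
      · exact hs.disjoint m n hmn y hy
    · rw [Function.update_of_ne hm]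
      by_cases hn : n = i
      · subst hn
        rw [Function.update_self, Finset.mem_insert]
        rintro hy (rfl | hy')
        · exact hunused m hy
        · exact hs.disjoint m n hmn y hy hy'
      · rw [Function.update_of_ne hn]
        exact hs.disjoint m n hmn y
  · intro m y hy hyl n
    refine le_trans ?_ (hmono n)
    by_cases hm : m = i
    · subst hm
      rw [Function.update_self] at hy hyl
      by_cases h : y = last m
      · rw [h]
      · exact hs.behind m y ((Finset.mem_insert.1 hy).resolve_left hyl) h m
    · rw [Function.update_of_ne hm] at hy hyl
      exact hs.behind m y hy hyl i
  · intro m t hat ht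
    by_cases hm : m = i
    · subst hm
      rw [Function.update_self] at ht ⊢
      rcases le_total t (hi (last m)) with h | h
      · obtain ⟨y, hy, hyt⟩ := hs.cover m t hat h
        exact ⟨y, Finset.mem_insert_of_mem hy, hyt⟩
      · exact ⟨x, Finset.mem_insert_self _ _, hx.1.trans h, ht⟩
    · rw [Function.update_of_ne hm] at ht ⊢
      exact hs.cover m t hat ht
  · refine Finset.sum_lt_sum (fun m _ => ?_) ⟨i, Finset.mem_univ _, ?_⟩
    · by_cases hm : m = i
      · subst hm
        rw [Function.update_self]
        exact Finset.card_le_card (Finset.subset_insert _ _)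
      · rw [Function.update_of_ne hm]
    · rw [Function.update_self, Finset.card_insert_of_notMem (hunused i)]
      exact Nat.lt_succ_self _

/-- The sweep can be started with single vertices. -/
theorem exists_sweepState [Fintype V] [DecidableEq V]
    (hG : ∀ u v : V, u ≠ v →
      (G.Adj u v ↔ (Set.Icc (lo u) (hi u) ∩ Set.Icc (lo v) (hi v)).Nonempty))
    (hconn : KConnected G k) (hle : ∀ v, lo v ≤ hi v) (A : V) :
    ∃ (last : Fin k → V) (used : Fin k → Finset V), SweepState G lo hi (hi A) last used := by
  have hcard : k ≤ (Finset.univ.filter fun v => lo v ≤ hi A).card := by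
    by_cases h : ∃ B, hi A < lo B
    · obtain ⟨B, hB⟩ := h
      refine (le_card_crossing hG hconn le_rfl hB hle).trans (Finset.card_le_card fun v hv => ?_)
      simp only [Finset.mem_filter] at hv ⊢
      exact ⟨hv.1, hv.2.1⟩
    · push Not at h
      rw [Finset.filter_true_of_mem fun v _ => h v]
      exact hconn.1.le
  obtain ⟨s, hs, hsk⟩ := Finset.exists_subset_card_eq hcard
  let e := (s.equivFinOfCardEq hsk).symm
  refine ⟨fun i => e i, fun i => {(e i : V)}, ⟨fun i => ⟨_, .nil, .nil, by simp⟩, ?_, ?_, ?_⟩⟩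
  · intro i j hij x hx hx'
    rw [Finset.mem_singleton] at hx hx'
    exact hij (e.injective (Subtype.ext (hx.symm.trans hx')))
  · intro i x hx hne
    exact absurd (Finset.mem_singleton.1 hx) hne
  · intro i t hat ht
    exact ⟨e i, Finset.mem_singleton_self _,
      ((Finset.mem_filter.1 (hs (e i).2)).2).trans hat, ht⟩

/-- Some state of the sweep has all its paths reaching the left endpoint of `B`. -/
theorem exists_complete_sweepState [Fintype V] [DecidableEq V]
    (hG : ∀ u v : V, u ≠ v →
      (G.Adj u v ↔ (Set.Icc (lo u) (hi u) ∩ Set.Icc (lo v) (hi v)).Nonempty))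
    (hconn : KConnected G k) (hle : ∀ v, lo v ≤ hi v) {A : V} (B : V)
    (hA : ∀ v, hi A ≤ hi v) :
    ∃ (last : Fin k → V) (used : Fin k → Finset V),
      SweepState G lo hi (hi A) last used ∧ ∀ j, lo B ≤ hi (last j) := by
  by_contra! hcon
  have hunbounded : ∀ n : ℕ, ∃ (last : Fin k → V) (used : Fin k → Finset V),
      SweepState G lo hi (hi A) last used ∧ n ≤ ∑ i, (used i).card := by
    intro n
    induction n with
    | zero =>
      obtain ⟨last, used, hs⟩ := exists_sweepState hG hconn hle A
      exact ⟨last, used, hs, Nat.zero_le _⟩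
    | succ n ih =>
      obtain ⟨last, used, hs, hn⟩ := ih
      obtain ⟨j, hj⟩ := hcon last used hs
      obtain ⟨last', used', hs', hlt⟩ := hs.extend hG hconn hle hA hj
      exact ⟨last', used', hs', hn.trans_lt hlt⟩
  obtain ⟨last, used, -, hn⟩ := hunbounded ((∑ _i : Fin k, Fintype.card V) + 1)
  exact absurd (hn.trans (Finset.sum_le_sum fun i _ => (used i).card_le_univ)) (by simp)

end IntervalSweep

/-- Every `k`-connected interval graph contains `k` pairwise vertex-disjoint paths whose
vertex sets are dominating sets; in particular each is a connected dominating set. -/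
theorem interval_disjoint_dominating_paths {V : Type} [Fintype V] [DecidableEq V]
    (G : SimpleGraph V) (k : ℕ)
    (hint : IsIntervalGraph G) (hconn : KConnected G k) :
    ∃ (u v : Fin k → V) (P : ∀ i : Fin k, G.Walk (u i) (v i)),
      (∀ i, (P i).IsPath) ∧
      (Pairwise fun i j => ∀ x : V, x ∈ (P i).support → x ∉ (P j).support) ∧
      (∀ i, ∀ w : V, w ∈ (P i).support ∨ ∃ x ∈ (P i).support, G.Adj w x) ∧
      (∀ i, IsCDS G {x | x ∈ (P i).support}) := by
  obtain ⟨lo, hi, hle, hG⟩ := hint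
  have : Nonempty V := Fintype.card_pos_iff.1 (Nat.zero_lt_of_lt hconn.1)
  obtain ⟨A, hA⟩ := Finite.exists_min hi
  obtain ⟨B, hB⟩ := Finite.exists_max lo
  obtain ⟨last, used, hs, hend⟩ :=
    IntervalSweep.exists_complete_sweepState hG hconn hle B hA
  choose u P hP hsupp using hs.path
  have hdom : ∀ i, ∀ w : V, w ∈ (P i).support ∨ ∃ x ∈ (P i).support, G.Adj w x := by
    intro i w
    obtain ⟨x, hx, hx1, hx2⟩ := hs.cover i (max (hi A) (lo w)) (le_max_left _ _)
      (max_le (hA _) ((hB w).trans (hend i)))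
    by_cases h : w = x
    · exact Or.inl ((hsupp i w).2 (h ▸ hx))
    · exact Or.inr ⟨x, (hsupp i x).2 hx, (hG w x h).2
        ⟨_, ⟨le_max_right _ _, max_le (hA w) (hle w)⟩, ⟨hx1, hx2⟩⟩⟩
  refine ⟨last, u, P, hP, fun i j hij x hx hx' => ?_, hdom, fun i => ⟨?_, hdom i⟩⟩
  · exact hs.disjoint i j hij x ((hsupp i x).1 hx) ((hsupp j x).1 hx')
  · exact (P i).connected_induce_support
end

section
/- There exists a 2-connected convex bipartite graph that admits no CDS partition of size 2. -/
/-- `G` admits a CDS partition of size `k`. -/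
def HasCDSPartition {V : Type} (G : SimpleGraph V) (k : ℕ) : Prop :=
  ∃ D : Fin k → Set V,
    (Pairwise fun i j => Disjoint (D i) (D j)) ∧
    (⋃ i, D i) = Set.univ ∧
    ∀ i, IsCDS G (D i)

/-- `G` is a convex bipartite graph: there is a bipartition `(A, B)` and an ordering of
`A` (an injective-on-`A` map to `ℕ`) such that the neighbourhood of every vertex of `B`
is consecutive in the ordering of `A`. -/
def IsConvexBipartite {V : Type} (G : SimpleGraph V) : Prop :=
  ∃ (A B : Set V) (f : V → ℕ),
    A ∪ B = Set.univ ∧ Disjoint A B ∧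
    (∀ u v : V, G.Adj u v → (u ∈ A ∧ v ∈ B) ∨ (u ∈ B ∧ v ∈ A)) ∧
    Set.InjOn f A ∧
    (∀ b ∈ B, ∀ a₁ ∈ A, ∀ a₂ ∈ A, ∀ a₃ ∈ A,
      f a₁ ≤ f a₂ → f a₂ ≤ f a₃ → G.Adj a₁ b → G.Adj a₃ b → G.Adj a₂ b)

namespace SimpleGraph

variable {V : Type*} {G : SimpleGraph V} {D : Set V}

/-- A set is connected when a self-map of it moving every vertex to itself or to a neighbour has an
iterate that is constant on it. -/
theorem induce_connected_of_iterate (p : V → V) (r : V) (k : ℕ) (hr : r ∈ D)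
    (hp : ∀ v ∈ D, p v ∈ D ∧ (p v = v ∨ G.Adj v (p v))) (hk : ∀ v ∈ D, p^[k] v = r) :
    (G.induce D).Connected := by
  have reach : ∀ (m : ℕ) (v : D), ∃ h : p^[m] v ∈ D, (G.induce D).Reachable v ⟨p^[m] v, h⟩ := by
    intro m v
    induction m with
    | zero => exact ⟨v.2, .rfl⟩
    | succ m ih =>
      obtain ⟨h, hv⟩ := ih
      obtain ⟨h', hadj⟩ := hp _ h
      simp only [Function.iterate_succ_apply']
      refine ⟨h', hv.trans ?_⟩
      rcases hadj with heq | hadj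
      · simp only [heq]
        exact .rfl
      · exact Adj.reachable (G := G.induce D) (u := ⟨_, h⟩) (v := ⟨_, h'⟩) hadj
  refine (connected_iff_exists_forall_reachable _).2 ⟨⟨r, hr⟩, fun v => ?_⟩
  obtain ⟨h, hv⟩ := reach k v
  simp only [hk v v.2] at hv
  exact hv.symm

/-- A connected induced subgraph has an edge across every cut that separates it. -/
theorem exists_adj_of_induce_connected (h : (G.induce D).Connected) (S : Set V)
    (hS : ∃ x ∈ D, x ∈ S) (hS' : ∃ y ∈ D, y ∉ S) :
    ∃ u ∈ D, u ∈ S ∧ ∃ v ∈ D, v ∉ S ∧ G.Adj u v := by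
  obtain ⟨x, hx, hxS⟩ := hS
  obtain ⟨y, hy, hyS⟩ := hS'
  obtain ⟨w⟩ := h.preconnected ⟨x, hx⟩ ⟨y, hy⟩
  obtain ⟨d, -, h₁, h₂⟩ := w.exists_boundary_dart (Subtype.val ⁻¹' S) hxS hyS
  exact ⟨d.fst, d.fst.2, h₁, d.snd, d.snd.2, h₂, d.adj⟩

end SimpleGraph

/-- The convex bipartite graph with parts `{0, 1, 2, 3}` and `{4, 5, 6, 7}`, in which `4`, `5`, `6`,
`7` are joined to the intervals `[0, 1]`, `[0, 3]`, `[1, 2]`, `[2, 3]` respectively. -/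
def intervalGraph : SimpleGraph (Fin 8) :=
  SimpleGraph.fromRel fun u v =>
    (u, v) ∈ [(0, 4), (1, 4), (0, 5), (1, 5), (2, 5), (3, 5), (1, 6), (2, 6), (2, 7), (3, 7)]

instance : DecidableRel intervalGraph.Adj := fun u v =>
  inferInstanceAs (Decidable (u ≠ v ∧ (_ ∨ _)))

theorem intervalGraph_isConvexBipartite : IsConvexBipartite intervalGraph := by
  refine ⟨{v | v < 4}, {v | ¬ v < 4}, Fin.val, ?_, ?_, ?_, Fin.val_injective.injOn, ?_⟩
  · exact Set.union_compl_self _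
  · exact disjoint_compl_right
  · simp only [Set.mem_ofPred_eq]
    decide
  · simp only [Set.mem_ofPred_eq]
    decide

/-- For each `x`, the parent map of a spanning tree of `intervalGraph` with `x` deleted. -/
def intervalGraphParent (x : Fin 8) : Fin 8 → Fin 8 :=
  if x = 5 then ![4, 6, 7, 3, 1, 3, 2, 3]
  else ![5, 5, 5, 5, if x = 0 then 1 else 0, 5, if x = 1 then 2 else 1, if x = 2 then 3 else 2]

theorem intervalGraph_kConnected : KConnected intervalGraph 2 := by
  refine ⟨by decide, fun S hS => ?_⟩
  rcases S.eq_empty_or_nonempty with rfl | hne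
  · refine SimpleGraph.induce_connected_of_iterate (intervalGraphParent 4) 5 2 (by simp) ?_ ?_
    · simp only [Finset.coe_empty, Set.compl_empty, Set.mem_univ, true_and, forall_const]
      decide
    · simp only [Finset.coe_empty, Set.compl_empty, Set.mem_univ, forall_const]
      decide
  · obtain ⟨x, rfl⟩ := Finset.card_eq_one.1 (by have := hne.card_pos; omega : S.card = 1)
    refine SimpleGraph.induce_connected_of_iterate (intervalGraphParent x)
      (if x = 5 then 3 else 5) 6 ?_ ?_ ?_ <;>
      simp only [Finset.coe_singleton, Set.mem_compl_iff, Set.mem_singleton_iff] <;>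
      revert x <;> decide

/-- In a partition of a graph into two connected dominating sets, the two neighbours of a vertex of
degree two lie in different parts. -/
theorem IsCDS.mem_iff_notMem_of_degree_two {V : Type} {G : SimpleGraph V} {D : Set V}
    (h : IsCDS G D) (h' : IsCDS G Dᶜ) {v a b : V} (hv : ∀ u, G.Adj v u ↔ u = a ∨ u = b)
    (hD : ∃ y ∈ D, y ≠ v) (hD' : ∃ y ∈ Dᶜ, y ≠ v) : a ∈ D ↔ b ∉ D := by
  have key : ∀ E : Set V, IsCDS G E → (∃ y ∈ E, y ≠ v) → a ∈ E ∨ b ∈ E := by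
    rintro E ⟨hc, hd⟩ hE
    have : ∃ u ∈ E, G.Adj v u := by
      refine (hd v).elim (fun hvE => ?_) id
      obtain ⟨_, -, rfl, u, hu, -, hadj⟩ :=
        SimpleGraph.exists_adj_of_induce_connected hc {v} ⟨v, hvE, rfl⟩ hE
      exact ⟨u, hu, hadj⟩
    obtain ⟨u, hu, hadj⟩ := this
    rcases (hv u).1 hadj with rfl | rfl <;> simp [hu]
  have h₁ := key D h hD
  have h₂ := key Dᶜ h' hD'
  simp only [Set.mem_compl_iff] at h₂
  tauto

theorem IsCDS.nontrivial_of_intervalGraph {D : Set (Fin 8)} (h : IsCDS intervalGraph D)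
    (v : Fin 8) : ∃ y ∈ D, y ≠ v := by
  by_contra! hD
  obtain ⟨w, hw, hvw⟩ : ∃ w, w ≠ v ∧ ¬ intervalGraph.Adj w v := by
    clear hD
    revert v
    decide
  rcases h.2 w with hwD | ⟨u, hu, hadj⟩
  · exact hw (hD w hwD)
  · exact hvw (hD u hu ▸ hadj)

theorem intervalGraph_not_isCDS_compl {D : Set (Fin 8)} (h : IsCDS intervalGraph D)
    (h5 : 5 ∉ D) : ¬ IsCDS intervalGraph Dᶜ := by
  intro h'
  have differ {v a b : Fin 8} (hv : ∀ u, intervalGraph.Adj v u ↔ u = a ∨ u = b) : a ∈ D ↔ b ∉ D :=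
    h.mem_iff_notMem_of_degree_two h' hv (h.nontrivial_of_intervalGraph v)
      (h'.nontrivial_of_intervalGraph v)
  have h45 := differ (v := 0) (a := 4) (b := 5) (by decide)
  have h57 := differ (v := 3) (a := 5) (b := 7) (by decide)
  have h01 := differ (v := 4) (a := 0) (b := 1) (by decide)
  have h12 := differ (v := 6) (a := 1) (b := 2) (by decide)
  have h23 := differ (v := 7) (a := 2) (b := 3) (by decide)
  have h4 : 4 ∈ D := h45.2 h5
  have h7 : 7 ∈ D := not_not.1 (mt h57.2 h5)
  have cut (S : Set (Fin 8)) := SimpleGraph.exists_adj_of_induce_connected h.1 S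
  by_cases h0 : 0 ∈ D
  · obtain ⟨u, hu, huS, v, hv, hvS, hadj⟩ := cut {0, 4} ⟨4, h4, by simp⟩ ⟨7, h7, by simp⟩
    have h1 : 1 ∉ D := h01.1 h0
    have : v = 0 ∨ v = 1 ∨ v = 4 ∨ v = 5 := by
      simp only [Set.mem_insert_iff, Set.mem_singleton_iff] at huS
      clear hvS hv hu
      revert u v
      decide
    rcases this with rfl | rfl | rfl | rfl <;> simp_all
  · obtain ⟨u, hu, huS, v, hv, hvS, hadj⟩ := cut {3, 7} ⟨7, h7, by simp⟩ ⟨4, h4, by simp⟩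
    have h2 : 2 ∉ D := by tauto
    have : v = 2 ∨ v = 3 ∨ v = 5 ∨ v = 7 := by
      simp only [Set.mem_insert_iff, Set.mem_singleton_iff] at huS
      clear hvS hv hu
      revert u v
      decide
    rcases this with rfl | rfl | rfl | rfl <;> simp_all

/-- There is a `2`-connected convex bipartite graph with no CDS partition of size `2`. -/
theorem exists_convex_bipartite_no_cds_partition :
    ∃ (n : ℕ) (G : SimpleGraph (Fin n)),
      IsConvexBipartite G ∧ KConnected G 2 ∧ ¬ HasCDSPartition G 2 := by
  refine ⟨8, intervalGraph, intervalGraph_isConvexBipartite, intervalGraph_kConnected, ?_⟩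
  rintro ⟨D, hdisj, hcover, hD⟩
  have hcompl : D 1 = (D 0)ᶜ := by
    refine (IsCompl.compl_eq ⟨hdisj (by decide), codisjoint_iff.2 ?_⟩).symm
    rw [Set.top_eq_univ, ← hcover]
    ext x
    simp [Fin.exists_fin_two]
  have h0 := hD 0
  have h1 := hcompl ▸ hD 1
  by_cases h5 : 5 ∈ D 0
  · exact intervalGraph_not_isCDS_compl h1 (by simpa) (by rwa [compl_compl])
  · exact intervalGraph_not_isCDS_compl h0 h5 h1
end
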